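/- arXiv:1508.05140 — 2 statements merged into one kernel-verified Lean document; each statement's English description precedes it below -/
import Mathlib

section
/- For every q > 1: (i) inf{ D(z,w) : z ∈ ∂Q_s, w ∈ q·∂Q_s } = (1 − q^{1−α}) / (κ̄_s·(α−1)); (ii) for every z ∈ ∂Q_s ∩ P_x one has D(z, z + (q−1)·x) = (1 − q^{1−α})/(κ̄_s·(α−1)), and for every z ∈ ∂Q_s ∩ P_{−x} one has D(z, z − (q−1)·x) = (1 − q^{1−α})/(κ̄_s·(α−1)); (iii) if z ∈ ∂Q_s and w ∈ q·∂Q_s satisfy D(z,w) = (1 − q^{1−α})/(κ̄_s·(α−1)), then z ∈ P_x ∪ P_{−x} and either w = z + (q−1)·x or w = z − (q−1)·x. -/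
open MeasureTheory Metric
open scoped ENNReal NNReal Pointwise RealInnerProductSpace

/-- The `D`-length of the linear segment from `a` to `b`, parametrized by `μ`-length:
`μ(b-a) · ∫_0^1 f(a + t(b-a))⁻¹ dt`. -/
noncomputable def segLen {d : ℕ} (μ f : EuclideanSpace ℝ (Fin d) → ℝ)
    (a b : EuclideanSpace ℝ (Fin d)) : ℝ≥0∞ :=
  ENNReal.ofReal (μ (b - a)) *
    ∫⁻ t in Set.Ioo (0 : ℝ) 1, ENNReal.ofReal ((f (a + t • (b - a)))⁻¹)

/-- `D(z,w)`: the infimum of `D`-lengths of piecewise linear paths from `z` to `w`,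
encoded via their finite sequences of vertices. -/
noncomputable def Dmet {d : ℕ} (μ f : EuclideanSpace ℝ (Fin d) → ℝ)
    (z w : EuclideanSpace ℝ (Fin d)) : ℝ≥0∞ :=
  ⨅ (n : ℕ) (p : Fin (n + 1) → EuclideanSpace ℝ (Fin d)) (_ : p 0 = z)
    (_ : p (Fin.last n) = w),
    ∑ i : Fin n, segLen μ f (p i.castSucc) (p i.succ)

lemma seg_core {d : ℕ} (μ f m Ψ : EuclideanSpace ℝ (Fin d) → ℝ)
    (hμ_smul : ∀ (c : ℝ) z, μ (c • z) = |c| * μ z)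
    (hμ0 : ∀ z, 0 ≤ μ z)
    (hm : Continuous m) (hm0 : ∀ y, 0 ≤ m y) (hmf : ∀ y, y ≠ 0 → m y ≤ (f y)⁻¹)
    (hΨ : Continuous Ψ)
    (hloc : ∀ y, ∀ᶠ y' in nhds y, Ψ y' - Ψ y ≤ μ (y' - y) * max (m y) (m y'))
    (a b : EuclideanSpace ℝ (Fin d)) :
    ENNReal.ofReal (Ψ b - Ψ a) ≤ segLen μ f a b := by
  by_cases hab : a = b
  · subst hab; simp
  set v := b - a with hv
  have hv0 : v ≠ 0 := sub_ne_zero.mpr (Ne.symm hab)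
  have hline : Continuous (fun t : ℝ => a + t • v) := by fun_prop
  have hmc : Continuous (fun t : ℝ => μ v * m (a + t • v)) := by fun_prop
  have key : ∀ t ∈ Set.Icc (0:ℝ) 1, Ψ (a + t • v) ≤
      Ψ a + ∫ r in (0:ℝ)..t, μ v * m (a + r • v) := by
    intro t ht
    have hB : ∀ t : ℝ, HasDerivAt (fun t => Ψ a + ∫ r in (0:ℝ)..t, μ v * m (a + r • v))
        (μ v * m (a + t • v)) t := by
      intro t
      apply HasDerivAt.const_add
      exact intervalIntegral.integral_hasDerivAt_right (hmc.intervalIntegrable _ _)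
        hmc.aestronglyMeasurable.stronglyMeasurableAtFilter hmc.continuousAt
    refine image_le_of_liminf_slope_right_le_deriv_boundary (f := fun t => Ψ (a + t • v))
      (B := fun t => Ψ a + ∫ r in (0:ℝ)..t, μ v * m (a + r • v))
      (B' := fun t => μ v * m (a + t • v)) (a := 0) (b := 1)
      (hΨ.comp hline).continuousOn (by simp) ?_ ?_ ?_ ht
    · exact fun t _ => (hB t).continuousAt.continuousWithinAt
    · exact fun t _ => (hB t).hasDerivWithinAt
    · intro t _ r hr
      apply Filter.Eventually.frequently
      have h1 : ∀ᶠ z in nhds t, Ψ (a + z • v) - Ψ (a + t • v) ≤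
          μ (a + z • v - (a + t • v)) * max (m (a + t • v)) (m (a + z • v)) :=
        hline.continuousAt.eventually (hloc (a + t • v))
      have h2 : ∀ᶠ z in nhds t, μ v * max (m (a + t • v)) (m (a + z • v)) < r := by
        have hc : Continuous (fun z : ℝ => μ v * max (m (a + t • v)) (m (a + z • v))) := by
          fun_prop
        refine hc.continuousAt.eventually (gt_mem_nhds ?_)
        simpa using hr
      filter_upwards [nhdsWithin_le_nhds h1, nhdsWithin_le_nhds h2, self_mem_nhdsWithin] with z a1 a2 a3
      have a3' : 0 < z - t := sub_pos.mpr a3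
      rw [slope_def_field, div_lt_iff₀ a3']
      have e : a + z • v - (a + t • v) = (z - t) • v := by module
      rw [e, hμ_smul, abs_of_pos a3'] at a1
      nlinarith
  have h1 := key 1 (by simp)
  have e1 : a + (1:ℝ) • v = b := by simp [hv]
  rw [e1] at h1
  have h2 : Ψ b - Ψ a ≤ ∫ r in (0:ℝ)..1, μ v * m (a + r • v) := by linarith
  refine (ENNReal.ofReal_le_ofReal h2).trans ?_
  rw [intervalIntegral.integral_const_mul, ENNReal.ofReal_mul (hμ0 v)]
  unfold segLen
  rw [← hv]
  gcongr
  have hmc2 : Continuous (fun t : ℝ => m (a + t • v)) := by fun_prop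
  rw [intervalIntegral.integral_of_le zero_le_one, ← integral_Ioc_eq_integral_Ioo.symm,
    ofReal_integral_eq_lintegral_ofReal]
  · apply lintegral_mono_ae
    apply ae_restrict_of_ae
    have : ∀ᵐ t : ℝ, t ∉ {t : ℝ | a + t • v = 0} := by
      rw [← measure_eq_zero_iff_ae_notMem]
      apply Set.Subsingleton.measure_zero
      intro t ht r hr
      change a + t • v = 0 at ht
      change a + r • v = 0 at hr
      have : (t - r) • v = 0 := by
        have : (t - r) • v = (a + t • v) - (a + r • v) := by module
        rw [this, ht, hr, sub_zero]
      rcases smul_eq_zero.mp this with h | h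
      · linarith
      · exact absurd h hv0
    filter_upwards [this] with t ht
    exact ENNReal.ofReal_le_ofReal (hmf _ ht)
  · have := (hmc2.intervalIntegrable (μ := volume) 0 1).1
    exact this.mono_set Set.Ioo_subset_Ioc_self
  · exact Filter.Eventually.of_forall fun t => hm0 _

lemma dmet_core {d : ℕ} (μ f Ψ : EuclideanSpace ℝ (Fin d) → ℝ)
    (h : ∀ a b, ENNReal.ofReal (Ψ b - Ψ a) ≤ segLen μ f a b)
    (z w : EuclideanSpace ℝ (Fin d)) :
    ENNReal.ofReal (Ψ w - Ψ z) ≤ Dmet μ f z w := by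
  unfold Dmet
  refine le_iInf fun n => le_iInf fun p => le_iInf fun h0 => le_iInf fun h1 => ?_
  subst h0 h1
  induction n with
  | zero => simp
  | succ n ih =>
    rw [Fin.sum_univ_castSucc]
    have := ih (fun i => p i.castSucc)
    have e : Ψ (p (Fin.last (n+1))) - Ψ (p 0) =
      (Ψ (p (Fin.last n).castSucc) - Ψ (p 0)) + (Ψ (p (Fin.last (n+1))) - Ψ (p (Fin.last n).castSucc)) := by ring
    rw [e]
    refine ENNReal.ofReal_add_le.trans ?_
    refine add_le_add this ?_
    exact h _ _

/-- truncated comparison -/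
lemma dmet_lower {d : ℕ} (μ f m Ψ ν : EuclideanSpace ℝ (Fin d) → ℝ) (R : ℝ)
    (hμ_smul : ∀ (c : ℝ) z, μ (c • z) = |c| * μ z)
    (hμ0 : ∀ z, 0 ≤ μ z)
    (hm : Continuous m) (hm0 : ∀ y, 0 ≤ m y) (hmf : ∀ y, y ≠ 0 → m y ≤ (f y)⁻¹)
    (hΨ : Continuous Ψ)
    (hloc : ∀ y, ν y < R → ∀ᶠ y' in nhds y, Ψ y' - Ψ y ≤ μ (y' - y) * max (m y) (m y'))
    (z w : EuclideanSpace ℝ (Fin d)) (hR : ∀ y, R ≤ ν y → Ψ w ≤ Ψ y) :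
    ENNReal.ofReal (Ψ w - Ψ z) ≤ Dmet μ f z w := by
  have := dmet_core μ f (fun y => min (Ψ y) (Ψ w))
    (seg_core μ f m _ hμ_smul hμ0 hm hm0 hmf (by fun_prop) ?_) z w
  · refine le_trans (ENNReal.ofReal_le_ofReal ?_) this
    have := min_le_left (Ψ z) (Ψ w)
    rw [min_self]
    linarith
  · intro y
    have hnn : ∀ y', 0 ≤ μ (y' - y) * max (m y) (m y') := fun y' =>
      mul_nonneg (hμ0 _) (le_max_of_le_left (hm0 _))
    rcases lt_or_ge (ν y) R with h | h
    · filter_upwards [hloc y h] with y' h'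
      have h2 := hnn y'
      rcases min_cases (Ψ y) (Ψ w) with ⟨e, _⟩ | ⟨e, _⟩ <;>
      rcases min_cases (Ψ y') (Ψ w) with ⟨e', _⟩ | ⟨e', _⟩ <;> rw [e, e'] <;> linarith
    · refine Filter.Eventually.of_forall fun y' => ?_
      have h2 := hnn y'
      have := min_eq_right (hR y h)
      have h3 := min_le_right (Ψ y') (Ψ w)
      simp only [this]
      linarith

/-- radial potential -/
noncomputable def phiR (α κ r : ℝ) : ℝ := -((max r 1) ^ (1 - α) / ((α - 1) * κ))
/-- radial density -/
noncomputable def densR (α κ r : ℝ) : ℝ := (max r 1) ^ (-α) / κ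

lemma phiR_cont (α κ : ℝ) : Continuous (phiR α κ) := by
  unfold phiR
  refine Continuous.neg (Continuous.div_const (Continuous.rpow_const (by fun_prop) ?_) _)
  intro r; left; have := le_max_right r 1; linarith

lemma densR_cont (α κ : ℝ) : Continuous (densR α κ) := by
  unfold densR
  refine (Continuous.div_const (Continuous.rpow_const (by fun_prop) ?_) _)
  intro r; left; have := le_max_right r 1; linarith

lemma densR_pos {α κ : ℝ} (hκ : 0 < κ) (r : ℝ) : 0 < densR α κ r := by
  unfold densR
  have := le_max_right r 1
  positivity

lemma densR_anti {α κ : ℝ} (hα : 1 < α) (hκ : 0 < κ) {r r' : ℝ} (h : r ≤ r') :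
    densR α κ r' ≤ densR α κ r := by
  unfold densR
  have h1 := le_max_right r 1
  have h2 : max r 1 ≤ max r' 1 := max_le_max_right _ h
  gcongr ?_ / _
  exact Real.rpow_le_rpow_of_nonpos (by linarith) h2 (by linarith)

lemma phiR_mono {α κ : ℝ} (hα : 1 < α) (hκ : 0 < κ) {r r' : ℝ} (h : r ≤ r') :
    phiR α κ r ≤ phiR α κ r' := by
  unfold phiR
  have h1 := le_max_right r 1
  have h2 : max r 1 ≤ max r' 1 := max_le_max_right _ h
  have h3 : 0 < (α - 1) * κ := mul_pos (by linarith) hκ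
  apply neg_le_neg
  gcongr ?_ / _
  exact Real.rpow_le_rpow_of_nonpos (by linarith) h2 (by linarith)

lemma phiR_strict {α κ : ℝ} (hα : 1 < α) (hκ : 0 < κ) {r r' : ℝ} (h1 : 1 ≤ r) (h : r < r') :
    phiR α κ r < phiR α κ r' := by
  unfold phiR
  have h3 : 0 < (α - 1) * κ := mul_pos (by linarith) hκ
  rw [max_eq_left h1, max_eq_left (h1.trans h.le)]
  apply neg_lt_neg
  gcongr ?_ / _
  exact Real.rpow_lt_rpow_of_neg (by linarith) h (by linarith)

lemma phiR_sub {α κ : ℝ} (hα : 1 < α) (hκ : 0 < κ) {r r' : ℝ} (h : r ≤ r') :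
    phiR α κ r' - phiR α κ r ≤ (max r' 1 - max r 1) * densR α κ r := by
  unfold phiR densR
  have h1 := le_max_right r 1
  have h2 : max r 1 ≤ max r' 1 := max_le_max_right _ h
  set A := max r 1
  set B := max r' 1
  have hA : 0 < A := by linarith
  have hB : 0 < B := by linarith
  have h3 : 0 < α - 1 := by linarith
  have e1 : B ^ (1 - α) = A ^ (1 - α) * (B / A) ^ (1 - α) := by
    rw [← Real.mul_rpow hA.le (by positivity)]; congr 1; field_simp
  have e2 : A ^ (-α) = A ^ (1 - α) / A := by
    rw [show -α = (1 - α) - 1 by ring, Real.rpow_sub_one hA.ne']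
  have e3 : 1 + (1 - α) * (B / A - 1) ≤ (B / A) ^ (1 - α) := by
    have hBA : 0 < B / A := by positivity
    rw [Real.rpow_def_of_pos hBA]
    have l1 := Real.log_le_sub_one_of_pos hBA
    have l2 := Real.add_one_le_exp (Real.log (B / A) * (1 - α))
    nlinarith
  rw [e1, e2]
  have hP : 0 < A ^ (1 - α) := by positivity
  set P := A ^ (1 - α)
  set T := (B / A) ^ (1 - α)
  have e4 : 1 - T ≤ (α - 1) * ((B - A) / A) := by
    have : (B - A) / A = B / A - 1 := by field_simp
    rw [this]; linarith
  have : -(P * T / ((α - 1) * κ)) - -(P / ((α - 1) * κ)) = P / ((α - 1) * κ) * (1 - T) := by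
    field_simp; ring
  rw [this]
  have : (B - A) * (P / A / κ) = P / ((α - 1) * κ) * ((α - 1) * ((B - A) / A)) := by
    field_simp
  rw [this]
  gcongr

lemma phiR_abs {α κ : ℝ} (hα : 1 < α) (hκ : 0 < κ) (r r' : ℝ) :
    phiR α κ r' - phiR α κ r ≤ |max r' 1 - max r 1| * max (densR α κ r) (densR α κ r') := by
  rcases le_total r r' with h | h
  · refine (phiR_sub hα hκ h).trans ?_
    have := densR_pos (α := α) hκ r
    gcongr
    · exact le_abs_self _
    · exact le_max_left _ _
  · have := phiR_mono hα hκ h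
    have := densR_pos (α := α) hκ r
    have : 0 ≤ |max r' 1 - max r 1| * max (densR α κ r) (densR α κ r') := by positivity
    linarith

/-- geometric facts -/
structure Geo {d : ℕ} (μ ν τ u f : EuclideanSpace ℝ (Fin d) → ℝ)
    (p : EuclideanSpace ℝ (Fin d) → EuclideanSpace ℝ (Fin d)) (s α κ : ℝ) : Prop where
  μ_smul : ∀ (c : ℝ) z, μ (c • z) = |c| * μ z
  μ0 : ∀ z, 0 ≤ μ z
  ν_cont : Continuous ν
  ν_sub : ∀ a b, |ν a - ν b| ≤ ν (a - b)
  τ_cont : Continuous τ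
  τ_sub : ∀ a b, τ (a - b) = τ a - τ b
  p_sub : ∀ a b, p (a - b) = p a - p b
  u_cont : Continuous u
  u0 : ∀ a, 0 ≤ u a
  u_sub : ∀ a b, u a - u b ≤ u (a - b)
  u_eq : ∀ a, u a = 0 → p a = 0
  u_zero : u 0 = 0
  τ_le : ∀ y, |τ y| ≤ ν y
  νp_le : ∀ y, ν (p y) ≤ ν y
  ν_le : ∀ y, ν y ≤ max |τ y| (ν (p y))
  νp_u : ∀ y, ν (p y) ≤ u y / s
  sq_le : ∀ y, τ y ^ 2 + u y ^ 2 ≤ μ y ^ 2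
  hs : 1 < s
  hα : 1 < α
  hκ : 0 < κ
  hf : ∀ y, y ≠ 0 → densR α κ (ν y) ≤ (f y)⁻¹

namespace Geo

variable {d : ℕ} {μ ν τ u f : EuclideanSpace ℝ (Fin d) → ℝ}
    {p : EuclideanSpace ℝ (Fin d) → EuclideanSpace ℝ (Fin d)} {s α κ : ℝ}

lemma τ_le_μ (G : Geo μ ν τ u f p s α κ) (y) : |τ y| ≤ μ y :=
  abs_le_of_sq_le_sq (by nlinarith [G.sq_le y, sq_nonneg (u y)]) (G.μ0 y)

lemma u_le_μ (G : Geo μ ν τ u f p s α κ) (y) : u y ≤ μ y :=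
  le_of_sq_le_sq (by nlinarith [G.sq_le y, sq_nonneg (τ y)]) (G.μ0 y)

lemma us_le (G : Geo μ ν τ u f p s α κ) (y) : u y / s ≤ u y :=
  div_le_self (G.u0 y) G.hs.le

lemma ν_le_μ (G : Geo μ ν τ u f p s α κ) (y) : ν y ≤ μ y :=
  (G.ν_le y).trans (max_le (G.τ_le_μ y) ((G.νp_u y).trans ((G.us_le y).trans (G.u_le_μ y))))

lemma lower (G : Geo μ ν τ u f p s α κ) {Ψ : EuclideanSpace ℝ (Fin d) → ℝ} (R : ℝ)
    (hΨ : Continuous Ψ)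
    (hloc : ∀ y, ν y < R → ∀ᶠ y' in nhds y, ν y' < R → Ψ y' - Ψ y ≤
      μ (y' - y) * max (densR α κ (ν y)) (densR α κ (ν y')))
    (z w : EuclideanSpace ℝ (Fin d)) (hR : ∀ y, R ≤ ν y → Ψ w ≤ Ψ y) :
    ENNReal.ofReal (Ψ w - Ψ z) ≤ Dmet μ f z w := by
  refine dmet_lower μ f (fun y => densR α κ (ν y)) Ψ ν R G.μ_smul G.μ0
    ((densR_cont α κ).comp G.ν_cont) (fun y => (densR_pos G.hκ _).le) G.hf hΨ ?_ z w hR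
  intro y hy
  filter_upwards [hloc y hy, G.ν_cont.continuousAt.eventually (gt_mem_nhds hy)] with y' h1 h2
  exact h1 h2

lemma phi_loc (G : Geo μ ν τ u f p s α κ) (y y' : EuclideanSpace ℝ (Fin d)) :
    phiR α κ (ν y') - phiR α κ (ν y) ≤
      ν (y' - y) * max (densR α κ (ν y)) (densR α κ (ν y')) := by
  refine (phiR_abs G.hα G.hκ _ _).trans ?_
  have := densR_pos (α := α) G.hκ (ν y)
  gcongr
  exact (abs_max_sub_max_le_abs _ _ _).trans (G.ν_sub _ _)

lemma base (G : Geo μ ν τ u f p s α κ) (z w : EuclideanSpace ℝ (Fin d)) :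
    ENNReal.ofReal (phiR α κ (ν w) - phiR α κ (ν z)) ≤ Dmet μ f z w := by
  refine G.lower (Ψ := fun y => phiR α κ (ν y)) (ν w) ((phiR_cont α κ).comp G.ν_cont) ?_ z w ?_
  · intro y _
    refine Filter.Eventually.of_forall fun y' _ => (G.phi_loc y y').trans ?_
    have := densR_pos (α := α) G.hκ (ν y)
    gcongr
    exact G.ν_le_μ _
  · intro y hy
    exact phiR_mono G.hα G.hκ hy

set_option maxHeartbeats 1000000 in
lemma perp (G : Geo μ ν τ u f p s α κ) {q : ℝ} (hq : 1 < q) {z w : EuclideanSpace ℝ (Fin d)}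
    (hz : ν z = 1) (hw : ν w = q)
    (hD : Dmet μ f z w ≤ ENNReal.ofReal (phiR α κ q - phiR α κ 1)) : p w = p z := by
  set c := densR α κ (q + 1) with hc
  have hc0 : 0 < c := densR_pos G.hκ _
  set L := phiR α κ q - phiR α κ 1 with hL
  have hL0 : 0 < L := sub_pos.mpr (phiR_strict G.hα G.hκ le_rfl hq)
  set Δ := phiR α κ (q + 1) - phiR α κ q with hΔ
  have hΔ0 : 0 < Δ := sub_pos.mpr (phiR_strict G.hα G.hκ hq.le (by linarith))
  by_contra hne
  have hu : 0 < u (w - z) := by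
    refine lt_of_le_of_ne (G.u0 _) fun h => hne ?_
    have := G.u_eq _ h.symm
    rw [G.p_sub] at this
    exact sub_eq_zero.mp this
  set h : EuclideanSpace ℝ (Fin d) → ℝ := fun y => min (u (y - z)) 1 with hh
  have hw0 : 0 < h w := lt_min hu one_pos
  have h1 : ∀ y, h y ≤ 1 := fun y => min_le_right _ _
  have h0 : ∀ y, 0 ≤ h y := fun y => le_min (G.u0 _) zero_le_one
  have hz0 : h z = 0 := by simp [hh, G.u_zero]
  have hs1 : 0 < 1 - 1 / s := by
    have := G.hs
    rw [sub_pos, div_lt_one (by linarith)]; exact this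
  obtain ⟨δ, hδ, d1, d2, d3, d4⟩ : ∃ δ : ℝ, 0 < δ ∧ δ ≤ 1 - 1 / s ∧ δ ≤ 1 / 2 ∧
      δ ≤ c * h w / (2 * L) ∧ δ ≤ Δ / (2 * c) := by
    refine ⟨min (min (1 - 1 / s) (1 / 2)) (min (c * h w / (2 * L)) (Δ / (2 * c))), ?_, ?_, ?_, ?_, ?_⟩
    · refine lt_min (lt_min hs1 (by norm_num)) (lt_min (by positivity) (by positivity))
    all_goals simp
  rw [le_div_iff₀ (by positivity)] at d3 d4
  have key := G.lower (Ψ := fun y => (1 - δ ^ 2) * phiR α κ (ν y) + δ * c * h y) (q + 1) ?_ ?_ z w ?_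
  · have k2 := key.trans hD
    rw [ENNReal.ofReal_le_ofReal_iff hL0.le] at k2
    simp only [hz, hw, hz0] at k2
    have : δ * (c * h w) ≤ δ * (δ * L) := by
      rw [hL] at k2 ⊢
      linarith
    have := le_of_mul_le_mul_left this hδ
    have : 0 < c * h w := by positivity
    nlinarith
  · have := (phiR_cont α κ).comp G.ν_cont
    have := G.u_cont
    have e : Continuous fun y => phiR α κ (ν y) := (phiR_cont α κ).comp G.ν_cont
    simp only [hh]
    fun_prop
  · intro y hy
    refine Filter.Eventually.of_forall fun y' hy' => ?_
    have a1 := G.phi_loc y y'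
    set M := max (densR α κ (ν y)) (densR α κ (ν y')) with hM
    have hcM : c ≤ M := (densR_anti G.hα G.hκ hy.le).trans (le_max_left _ _)
    have a2 : h y' - h y ≤ u (y' - y) := by
      have b1 := G.u_sub (y' - z) (y - z)
      have e : y' - z - (y - z) = y' - y := by abel
      rw [e] at b1
      have b2 := G.u0 (y' - y)
      simp only [hh]
      rcases min_cases (u (y' - z)) 1 with ⟨e, _⟩ | ⟨e, _⟩ <;>
      rcases min_cases (u (y - z)) 1 with ⟨e', _⟩ | ⟨e', _⟩ <;> rw [e, e'] <;> linarith
    set v := y' - y with hv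
    have u0 := G.u0 v
    have a3 : (1 - δ ^ 2) * ν v + δ * u v ≤ μ v := by
      have hd2 : 0 ≤ 1 - δ ^ 2 := by nlinarith
      have n1 : ν v ≤ max |τ v| (u v / s) := (G.ν_le v).trans (max_le_max_left _ (G.νp_u v))
      rcases le_max_iff.mp n1 with n | n
      · refine le_of_sq_le_sq ?_ (G.μ0 v)
        have n2 : (1 - δ ^ 2) * ν v + δ * u v ≤ (1 - δ ^ 2) * |τ v| + δ * u v := by
          have := mul_le_mul_of_nonneg_left n hd2
          linarith
        have n0 : 0 ≤ ν v := (abs_nonneg _).trans (G.τ_le v)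
        refine (pow_le_pow_left₀ (by positivity) n2 2).trans (le_trans ?_ (G.sq_le v))
        rw [← sq_abs (τ v)]
        have t0 := abs_nonneg (τ v)
        set t := |τ v|
        have : t ^ 2 + u v ^ 2 - ((1 - δ ^ 2) * t + δ * u v) ^ 2 =
          (δ * t - (1 - δ ^ 2) * u v) ^ 2 + (1 - δ ^ 2 - (1 - δ ^ 2) ^ 2) * (t ^ 2 + u v ^ 2) := by ring
        have : 0 ≤ (1 - δ ^ 2 - (1 - δ ^ 2) ^ 2) * (t ^ 2 + u v ^ 2) := by
          apply mul_nonneg _ (by positivity)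
          nlinarith [sq_nonneg δ]
        nlinarith [sq_nonneg (δ * t - (1 - δ ^ 2) * u v)]
      · have n0 : 0 ≤ ν v := (abs_nonneg _).trans (G.τ_le v)
        have n3 : δ * u v ≤ (1 - 1 / s) * u v := by gcongr
        have n4 : (1 - δ ^ 2) * ν v ≤ ν v := by nlinarith [sq_nonneg δ]
        have n5 : (1 - 1 / s) * u v = u v - u v / s := by ring
        have := G.u_le_μ v
        linarith
    have hM0 : 0 < M := hc0.trans_le hcM
    have hd2 : 0 ≤ 1 - δ ^ 2 := by nlinarith
    have c1 := mul_le_mul_of_nonneg_left a1 hd2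
    have c2 : δ * c * (h y' - h y) ≤ δ * M * u v := by
      calc _ ≤ δ * c * u v := by gcongr
        _ ≤ _ := by gcongr
    have c3 := mul_le_mul_of_nonneg_right a3 hM0.le
    linarith
  · intro y hy
    have := phiR_mono (α := α) G.hα G.hκ hy
    have b1 : Δ ≤ phiR α κ (ν y) - phiR α κ q := by rw [hΔ]; linarith
    simp only [hw]
    have b2 : δ * c * h w ≤ δ * c := mul_le_of_le_one_right (by positivity) (h1 w)
    have b3 : 0 ≤ δ * c * h y := mul_nonneg (by positivity) (h0 y)
    have b4 : 1 / 2 ≤ 1 - δ ^ 2 := by nlinarith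
    nlinarith

set_option maxHeartbeats 1000000 in
lemma strip (G : Geo μ ν τ u f p s α κ) {q : ℝ} (hq : 1 < q) {z w : EuclideanSpace ℝ (Fin d)}
    (hz : ν z = 1) (hw : ν w = q) (σ : ℝ) (hσ : |σ| = 1) (hσw : σ * τ w = q)
    (hD : Dmet μ f z w ≤ ENNReal.ofReal (phiR α κ q - phiR α κ 1)) : 1 ≤ σ * τ z := by
  set c := densR α κ (q + 1) with hc
  have hc0 : 0 < c := densR_pos G.hκ _
  set L := phiR α κ q - phiR α κ 1 with hL
  have hL0 : 0 < L := sub_pos.mpr (phiR_strict G.hα G.hκ le_rfl hq)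
  set Δ := phiR α κ (q + 1) - phiR α κ q with hΔ
  have hΔ0 : 0 < Δ := sub_pos.mpr (phiR_strict G.hα G.hκ hq.le (by linarith))
  have habs : ∀ y, |σ * τ y| = |τ y| := fun y => by rw [abs_mul, hσ, one_mul]
  set h : EuclideanSpace ℝ (Fin d) → ℝ := fun y => max (-1) (min (σ * τ y) 1) with hh
  have h1 : ∀ y, h y ≤ 1 := fun y => max_le (by norm_num) (min_le_right _ _)
  have h0 : ∀ y, -1 ≤ h y := fun y => le_max_left _ _
  have hw1 : h w = 1 := by simp only [hh, hσw]; rw [min_eq_right hq.le]; norm_num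
  have hs1 : 0 < 1 - 1 / s := by
    have := G.hs
    rw [sub_pos, div_lt_one (by linarith)]; exact this
  obtain ⟨δ, hδ, d1, d2⟩ : ∃ δ : ℝ, 0 < δ ∧ δ ≤ (1 - 1 / s) * c ∧ δ ≤ Δ / 2 := by
    refine ⟨min ((1 - 1 / s) * c) (Δ / 2), ?_, ?_, ?_⟩
    · refine lt_min (by positivity) (by positivity)
    all_goals simp
  have key := G.lower (Ψ := fun y => phiR α κ (ν y) + δ * h y) (q + 1) ?_ ?_ z w ?_
  · have k2 := key.trans hD
    rw [ENNReal.ofReal_le_ofReal_iff hL0.le] at k2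
    simp only [hz, hw, hw1] at k2
    have : δ * 1 ≤ δ * h z := by
      rw [hL] at k2
      linarith
    have := le_of_mul_le_mul_left this hδ
    simp only [hh] at this
    rcases le_max_iff.mp this with h' | h'
    · norm_num at h'
    · exact (le_min_iff.mp h').1
  · have := G.τ_cont
    have e : Continuous fun y => phiR α κ (ν y) := (phiR_cont α κ).comp G.ν_cont
    simp only [hh]
    fun_prop
  · intro y hy
    have hev : ∀ᶠ y' in nhds y, |σ * τ y' - σ * τ y| < 1 / 2 ∧
        (|τ y| < 1 → |τ y'| < 1) ∧ (1 < |τ y| → 1 < |τ y'|) := by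
      have := G.τ_cont
      refine Filter.Eventually.and ?_ (Filter.Eventually.and ?_ ?_)
      · have c1 : Continuous fun y' => |σ * τ y' - σ * τ y| := by fun_prop
        refine c1.continuousAt.eventually (gt_mem_nhds ?_)
        simp
      · by_cases hc : |τ y| < 1
        · have c1 : Continuous fun y' => |τ y'| := by fun_prop
          filter_upwards [c1.continuousAt.eventually (gt_mem_nhds hc)] with y' h _ using h
        · exact Filter.Eventually.of_forall fun _ h => absurd h hc
      · by_cases hc : 1 < |τ y|
        · have c1 : Continuous fun y' => |τ y'| := by fun_prop
          filter_upwards [c1.continuousAt.eventually (lt_mem_nhds hc)] with y' h _ using h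
        · exact Filter.Eventually.of_forall fun _ h => absurd h hc
    filter_upwards [hev] with y' ⟨e1, e2, e3⟩ hy'
    set M := max (densR α κ (ν y)) (densR α κ (ν y')) with hM
    have hcM : c ≤ M := (densR_anti G.hα G.hκ hy.le).trans (le_max_left _ _)
    have hM0 : 0 < M := hc0.trans_le hcM
    by_cases hst : |τ y| ≤ 1 ∧ |τ y'| ≤ 1
    · -- strip
      have m1 : ∀ y, |τ y| ≤ 1 → max (ν y) 1 = max (ν (p y)) 1 := by
        intro y hy
        apply le_antisymm
        · refine max_le ((G.ν_le y).trans (max_le (hy.trans (le_max_right _ _)) (le_max_left _ _))) (le_max_right _ _)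
        · exact max_le_max_right _ (G.νp_le y)
      have a1 : phiR α κ (ν y') - phiR α κ (ν y) ≤ u (y' - y) / s * M := by
        refine (phiR_abs G.hα G.hκ _ _).trans ?_
        rw [← hM]
        gcongr
        rw [m1 y hst.1, m1 y' hst.2]
        refine (abs_max_sub_max_le_abs _ _ _).trans ((G.ν_sub _ _).trans ?_)
        rw [← G.p_sub]
        exact G.νp_u _
      have a2 : h y' - h y ≤ |τ (y' - y)| := by
        rw [G.τ_sub, ← one_mul |τ y' - τ y|, ← hσ, ← abs_mul, mul_sub]
        have b1 := le_abs_self (σ * τ y' - σ * τ y)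
        have q1 := abs_le.mp ((habs y).trans_le hst.1)
        have q2 := abs_le.mp ((habs y').trans_le hst.2)
        simp only [hh]
        rw [min_eq_left q1.2, min_eq_left q2.2, max_eq_right q1.1, max_eq_right q2.1]
        exact b1
      set v := y' - y
      have c1 : δ * (h y' - h y) ≤ (1 - 1 / s) * M * |τ v| := by
        calc _ ≤ δ * |τ v| := by gcongr
          _ ≤ (1 - 1 / s) * c * |τ v| := by gcongr
          _ ≤ _ := by gcongr
      have c2 : (1 - 1 / s) * |τ v| ≤ (1 - 1 / s) * μ v := by gcongr; exact G.τ_le_μ v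
      have c3 : u v / s ≤ μ v / s := by
        have := G.hs
        gcongr; exact G.u_le_μ v
      have c4 : u v / s + (1 - 1 / s) * |τ v| ≤ μ v := by
        have : (1 - 1 / s) * μ v = μ v - μ v / s := by ring
        linarith
      have c5 := mul_le_mul_of_nonneg_right c4 hM0.le
      nlinarith
    · have heq : h y' = h y := by
        have t1 : 1 ≤ |τ y| := by
          by_contra hlt
          push Not at hlt
          exact hst ⟨hlt.le, (e2 hlt).le⟩
        have t2 : 1 ≤ |τ y'| := by
          by_contra hlt
          push Not at hlt
          rcases t1.lt_or_eq with t | t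
          · exact absurd (e3 t) (not_lt.mpr hlt.le)
          · exact hst ⟨t.symm.le, hlt.le⟩
        rw [← habs] at t1 t2
        have ⟨e4, e5⟩ := abs_lt.mp e1
        simp only [hh]
        rcases le_abs.mp t1 with t | t <;> rcases le_abs.mp t2 with t' | t'
        · rw [min_eq_right t, min_eq_right t']
        · linarith
        · linarith
        · rw [max_eq_left ((min_le_left _ _).trans (by linarith)),
            max_eq_left ((min_le_left _ _).trans (by linarith))]
      have a1 := G.phi_loc y y'
      have a2 := mul_le_mul_of_nonneg_right (G.ν_le_μ (y' - y)) hM0.le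
      rw [heq]
      linarith
  · intro y hy
    have := phiR_mono (α := α) G.hα G.hκ hy
    have b1 : Δ ≤ phiR α κ (ν y) - phiR α κ q := by rw [hΔ]; linarith
    simp only [hw, hw1]
    have := h0 y
    nlinarith

end Geo

lemma gauge_key {E : Type*} [NormedAddCommGroup E] [NormedSpace ℝ E] {S : Set E}
    (hc : Convex ℝ S) (hcl : IsClosed S) (h0 : S ∈ nhds 0) {r : ℝ} (hr : 0 < r) (y : E) :
    gauge S y ≤ r ↔ r⁻¹ • y ∈ S := by
  have := gauge_le_one_iff_mem_closure (x := r⁻¹ • y) hc h0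
  rw [hcl.closure_eq] at this
  rw [← this, gauge_smul_of_nonneg (by positivity), smul_eq_mul, inv_mul_le_iff₀ hr, mul_one]

/-- everything about the cylinder, packaged -/
lemma geo_facts (d : ℕ)
    (μ : EuclideanSpace ℝ (Fin d) → ℝ)
    (hμ_add : ∀ z w, μ (z + w) ≤ μ z + μ w)
    (hμ_smul : ∀ (c : ℝ) z, μ (c • z) = |c| * μ z)
    (hμ_eq : ∀ z, μ z = 0 ↔ z = 0)
    (ρ : ℝ) (hρ : IsLUB {r : ℝ | ∃ z : EuclideanSpace ℝ (Fin d), z ≠ 0 ∧ r = ‖z‖ / μ z} ρ)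
    (x : EuclideanSpace ℝ (Fin d)) (hx1 : μ x = 1) (hx2 : ‖x‖ = ρ)
    (s : ℝ) (hs : 1 < s)
    (Q : Set (EuclideanSpace ℝ (Fin d)))
    (hQplane : ∀ z ∈ Q, ⟪z, x⟫ = 0)
    (hQcomp : IsCompact Q) (hQconv : Convex ℝ Q)
    (hQsymm : ∀ z ∈ Q, -z ∈ Q)
    (hQball : ∀ z : EuclideanSpace ℝ (Fin d), ‖z‖ ≤ ρ → ⟪z, x⟫ = 0 → z ∈ Q)
    (Qs : Set (EuclideanSpace ℝ (Fin d)))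
    (hQs : Qs = {y | ∃ z ∈ Q, ∃ t ∈ Set.Icc (-1 : ℝ) 1, y = s • z + t • x})
    (Px Pnx : Set (EuclideanSpace ℝ (Fin d)))
    (hPx : Px = {z | ⟪z - x, x⟫ = 0}) (hPnx : Pnx = {z | ⟪z + x, x⟫ = 0})
    (α : ℝ) (hα : 1 < α)
    (fs : EuclideanSpace ℝ (Fin d) → ℝ)
    (hfspos : ∀ z ∈ frontier Qs, 0 < fs z)
    (κ : ℝ) (hκ : IsLUB (fs '' frontier Qs) κ)
    (hfsflat : ∀ z ∈ frontier Qs ∩ (Px ∪ Pnx), fs z = κ)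
    (f : EuclideanSpace ℝ (Fin d) → ℝ)
    (hf : ∀ z : EuclideanSpace ℝ (Fin d), z ≠ 0 →
      f z = gauge Qs z ^ α * fs ((gauge Qs z)⁻¹ • z)) :
    ∃ (τ : EuclideanSpace ℝ (Fin d) →L[ℝ] ℝ)
      (u : EuclideanSpace ℝ (Fin d) → ℝ),
      Geo μ (gauge Qs) τ u f (fun y => y - τ y • x) s α κ ∧
      (∀ y, y ∈ frontier Qs ↔ gauge Qs y = 1) ∧
      (∀ y, y ∈ Px ↔ τ y = 1) ∧ (∀ y, y ∈ Pnx ↔ τ y = -1) ∧ τ x = 1 := by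
  have hx0 : x ≠ 0 := fun h => by
    have := (hμ_eq x).mpr h
    rw [hx1] at this; exact one_ne_zero this
  have hρ0 : 0 < ρ := by rw [← hx2]; exact norm_pos_iff.mpr hx0
  have hμ0 : ∀ z, 0 ≤ μ z := by
    intro z
    have h1 := hμ_add z ((-1 : ℝ) • z)
    have h2 : z + (-1 : ℝ) • z = 0 := by module
    rw [h2, hμ_smul, (hμ_eq 0).mpr rfl] at h1
    norm_num at h1
    linarith
  have hnorm : ∀ z, ‖z‖ ≤ ρ * μ z := by
    intro z
    by_cases hz : z = 0
    · subst hz; simp [(hμ_eq 0).mpr rfl]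
    · have hp : 0 < μ z := lt_of_le_of_ne (hμ0 z) fun h => hz ((hμ_eq z).mp h.symm)
      rw [← div_le_iff₀ hp]
      exact hρ.1 ⟨z, hz, rfl⟩
  set τ : EuclideanSpace ℝ (Fin d) →L[ℝ] ℝ := (ρ ^ 2)⁻¹ • innerSL ℝ x with hτ
  have τe : ∀ y, τ y = (ρ ^ 2)⁻¹ * ⟪y, x⟫ := by
    intro y; simp [hτ, real_inner_comm]
  have hxx : ⟪x, x⟫ = ρ ^ 2 := by rw [real_inner_self_eq_norm_sq, hx2]
  have τx : τ x = 1 := by rw [τe, hxx]; field_simp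
  set p : EuclideanSpace ℝ (Fin d) →L[ℝ] EuclideanSpace ℝ (Fin d) :=
    ContinuousLinearMap.id ℝ _ - τ.smulRight x with hp
  have pe : ∀ y, p y = y - τ y • x := by intro y; simp [hp]
  have τp : ∀ y, τ (p y) = 0 := by intro y; rw [pe]; simp [τx]
  have pp : ∀ y, p (p y) = p y := by intro y; rw [pe (p y), τp]; simp
  have inner_τ : ∀ y, ⟪y, x⟫ = ρ ^ 2 * τ y := by intro y; rw [τe]; field_simp
  have pyth : ∀ y, ‖y‖ ^ 2 = ρ ^ 2 * τ y ^ 2 + ‖p y‖ ^ 2 := by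
    intro y
    have e : y = p y + τ y • x := by rw [pe]; abel
    have h0 : ⟪p y, τ y • x⟫ = 0 := by rw [inner_smul_right, inner_τ, τp]; ring
    conv_lhs => rw [e]
    rw [norm_add_sq_real, h0, norm_smul, hx2, Real.norm_eq_abs, mul_pow, sq_abs]
    ring
  have mem : ∀ y, y ∈ Qs ↔ |τ y| ≤ 1 ∧ s⁻¹ • p y ∈ Q := by
    intro y
    rw [hQs]
    constructor
    · rintro ⟨z, hz, t, ht, rfl⟩
      have tz : τ z = 0 := by rw [τe, hQplane z hz, mul_zero]
      have t1 : τ (s • z + t • x) = t := by simp [tz, τx]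
      refine ⟨by rw [t1]; exact abs_le.mpr ht, ?_⟩
      rw [pe, t1, add_sub_cancel_right, smul_smul, inv_mul_cancel₀ (by linarith), one_smul]
      exact hz
    · rintro ⟨h1, h2⟩
      refine ⟨_, h2, τ y, abs_le.mp h1, ?_⟩
      rw [smul_smul, mul_inv_cancel₀ (by linarith), one_smul, pe]; abel
  have hQse : Qs = τ ⁻¹' Set.Icc (-1) 1 ∩ (s⁻¹ • p) ⁻¹' Q := by
    ext y; rw [mem, abs_le]; rfl
  have hconv : Convex ℝ Qs := by
    rw [hQse]
    exact ((convex_Icc (-1 : ℝ) 1).linear_preimage τ.toLinearMap).inter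
      (hQconv.linear_preimage (s⁻¹ • p).toLinearMap)
  have hclosed : IsClosed Qs := by
    rw [hQse]
    exact (isClosed_Icc.preimage τ.continuous).inter
      (hQcomp.isClosed.preimage (s⁻¹ • p).continuous)
  have psmall : ∀ y, ‖p y‖ ≤ ‖y‖ := fun y =>
    le_of_sq_le_sq (by have := pyth y; nlinarith [mul_nonneg (sq_nonneg ρ) (sq_nonneg (τ y))]) (norm_nonneg _)
  have inQ : ∀ y, ‖p y‖ ≤ s * ρ → s⁻¹ • p y ∈ Q := by
    intro y hy
    apply hQball
    · rw [norm_smul, norm_inv, Real.norm_eq_abs, abs_of_pos (by linarith), inv_mul_le_iff₀ (by linarith)]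
      exact hy
    · rw [inner_τ, map_smul, τp]; simp
  have hnhds : Qs ∈ nhds 0 := by
    refine Filter.mem_of_superset (closedBall_mem_nhds 0 hρ0) ?_
    intro y hy
    have hy' : ‖y‖ ≤ ρ := by simpa using hy
    rw [mem]
    refine ⟨?_, inQ y ((psmall y).trans (hy'.trans ?_))⟩
    · apply abs_le_of_sq_le_sq _ zero_le_one
      have := pyth y
      have h2 : ‖y‖ ^ 2 ≤ ρ ^ 2 := by gcongr
      have h3 : ρ ^ 2 * τ y ^ 2 ≤ ρ ^ 2 * 1 := by nlinarith [sq_nonneg ‖p y‖]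
      have := le_of_mul_le_mul_left h3 (by positivity)
      linarith
    · nlinarith
  have key : ∀ {r : ℝ}, 0 < r → ∀ y, gauge Qs y ≤ r ↔ |τ y| ≤ r ∧ s⁻¹ • r⁻¹ • p y ∈ Q := by
    intro r hr y
    rw [gauge_key hconv hclosed hnhds hr, mem, map_smul, map_smul, smul_eq_mul, abs_mul,
      abs_of_pos (inv_pos.mpr hr), inv_mul_le_iff₀ hr, mul_one]
  have g0 : ∀ y, 0 ≤ gauge Qs y := gauge_nonneg
  have symm : ∀ y ∈ Qs, -y ∈ Qs := by
    intro y hy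
    rw [mem] at hy ⊢
    refine ⟨by rw [map_neg, abs_neg]; exact hy.1, ?_⟩
    rw [map_neg, smul_neg]; exact hQsymm _ hy.2
  have gadd := gauge_add_le hconv (absorbent_nhds_zero hnhds)
  have gsub : ∀ a b, gauge Qs a - gauge Qs b ≤ gauge Qs (a - b) := by
    intro a b
    have := gadd (a - b) b
    rw [sub_add_cancel] at this; linarith
  have τ_le : ∀ y, |τ y| ≤ gauge Qs y := by
    intro y
    refine le_of_forall_gt_imp_ge_of_dense fun r hr => ?_
    exact ((key ((g0 y).trans_lt hr) y).mp hr.le).1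
  have hfr : ∀ y, y ∈ frontier Qs ↔ gauge Qs y = 1 := fun y =>
    (gauge_eq_one_iff_mem_frontier hconv hnhds).symm
  have hPx' : ∀ y, y ∈ Px ↔ τ y = 1 := by
    intro y
    rw [hPx]
    change ⟪y - x, x⟫ = 0 ↔ _
    rw [inner_τ, map_sub, τx]
    constructor
    · intro h
      rcases mul_eq_zero.mp h with h | h
      · exact absurd h (by positivity)
      · linarith
    · intro h; rw [h]; ring
  have hPnx' : ∀ y, y ∈ Pnx ↔ τ y = -1 := by
    intro y
    rw [hPnx]
    change ⟪y + x, x⟫ = 0 ↔ _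
    rw [inner_τ, map_add, τx]
    constructor
    · intro h
      rcases mul_eq_zero.mp h with h | h
      · exact absurd h (by positivity)
      · linarith
    · intro h; rw [h]; ring
  have hxfr : x ∈ frontier Qs := by
    rw [hfr]
    apply le_antisymm
    · rw [key one_pos]
      refine ⟨by rw [τx]; simp, ?_⟩
      rw [inv_one, one_smul]
      apply inQ
      rw [pe, τx, one_smul, sub_self, norm_zero]
      positivity
    · have := τ_le x
      rw [τx, abs_one] at this; exact this
  have hκ0 : 0 < κ := by
    rw [← hfsflat x ⟨hxfr, Or.inl ((hPx' x).mpr τx)⟩]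
    exact hfspos x hxfr
  have νp_u : ∀ y, gauge Qs (p y) ≤ ‖p y‖ / ρ / s := by
    intro y
    refine le_of_forall_gt_imp_ge_of_dense fun r hr => ?_
    have hr0 : 0 < r := lt_of_le_of_lt (by positivity) hr
    rw [key hr0, τp, pp, abs_zero]
    refine ⟨hr0.le, ?_⟩
    rw [← map_smul]
    apply inQ
    rw [map_smul, norm_smul, norm_inv, Real.norm_eq_abs, abs_of_pos hr0, inv_mul_le_iff₀ hr0]
    rw [div_lt_iff₀ (by linarith), div_lt_iff₀ hρ0] at hr
    nlinarith
  have νpos : ∀ y, y ≠ 0 → 0 < gauge Qs y := by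
    intro y hy
    refine lt_of_le_of_ne (g0 y) fun h => hy ?_
    refine (gauge_eq_zero (absorbent_nhds_zero hnhds) ?_).mp h.symm
    have : Bornology.IsBounded Qs := by
      obtain ⟨C, hC⟩ := hQcomp.isBounded.exists_norm_le
      refine (isBounded_iff_forall_norm_le).mpr ⟨s * C + ρ, fun y hy => ?_⟩
      rw [mem] at hy
      have h1 := hC _ hy.2
      rw [norm_smul, norm_inv, Real.norm_eq_abs, abs_of_pos (by linarith), inv_mul_le_iff₀ (by linarith)] at h1
      have e : y = p y + τ y • x := by rw [pe]; abel
      rw [e]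
      refine (norm_add_le _ _).trans (add_le_add h1 ?_)
      rw [norm_smul, hx2, Real.norm_eq_abs]
      exact mul_le_of_le_one_left hρ0.le hy.1
    exact (NormedSpace.isVonNBounded_iff ℝ).mpr this
  have pe' : (fun y => y - τ y • x) = p := by funext y; rw [pe]
  refine ⟨τ, fun y => ‖p y‖ / ρ, ?_, hfr, hPx', hPnx', τx⟩
  rw [pe']
  exact
  { μ_smul := hμ_smul
    μ0 := hμ0
    ν_cont := continuous_gauge hconv hnhds
    ν_sub := by
      intro a b
      rw [abs_sub_le_iff]
      refine ⟨gsub a b, ?_⟩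
      rw [← gauge_neg symm (a - b), neg_sub]
      exact gsub b a
    τ_cont := τ.continuous
    τ_sub := fun a b => map_sub τ a b
    p_sub := fun a b => map_sub p a b
    u_cont := by fun_prop
    u0 := fun a => by positivity
    u_sub := by
      intro a b
      rw [map_sub, ← sub_div]
      gcongr
      exact norm_sub_norm_le _ _
    u_eq := by
      intro a ha
      have := (div_eq_zero_iff.mp ha).resolve_right hρ0.ne'
      exact norm_eq_zero.mp this
    u_zero := by simp
    τ_le := τ_le
    νp_le := by
      intro y
      refine le_of_forall_gt_imp_ge_of_dense fun r hr => ?_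
      have hr0 := (g0 y).trans_lt hr
      have := (key hr0 y).mp hr.le
      rw [key hr0, τp, pp, abs_zero]
      exact ⟨hr0.le, this.2⟩
    ν_le := by
      intro y
      refine le_of_forall_gt_imp_ge_of_dense fun r hr => ?_
      obtain ⟨h1, h2⟩ := max_lt_iff.mp hr
      have hr0 := (abs_nonneg _).trans_lt h1
      have := (key hr0 (p y)).mp h2.le
      rw [pp] at this
      rw [key hr0]
      exact ⟨h1.le, this.2⟩
    νp_u := νp_u
    sq_le := by
      intro y
      have h1 : ‖y‖ ^ 2 ≤ (ρ * μ y) ^ 2 := by gcongr; exact hnorm y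
      rw [pyth y, mul_pow] at h1
      rw [div_pow]
      refine le_of_mul_le_mul_left (le_trans (le_of_eq ?_) h1) (show 0 < ρ ^ 2 by positivity)
      field_simp
    hs := hs
    hα := hα
    hκ := hκ0
    hf := by
      intro y hy
      have hν := νpos y hy
      have hfrm : (gauge Qs y)⁻¹ • y ∈ frontier Qs := by
        rw [hfr, gauge_smul_of_nonneg (by positivity), smul_eq_mul, inv_mul_cancel₀ hν.ne']
      have b1 := hfspos _ hfrm
      have b2 : fs ((gauge Qs y)⁻¹ • y) ≤ κ := hκ.1 ⟨_, hfrm, rfl⟩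
      rw [hf y hy]
      unfold densR
      rw [mul_inv, div_eq_mul_inv, Real.rpow_neg (le_max_of_le_left hν.le)]
      gcongr
      exact le_max_left _ _ }

lemma L_eq {α κ q : ℝ} (hα : 1 < α) (hκ : 0 < κ) (hq : 1 < q) :
    phiR α κ q - phiR α κ 1 = (1 - q ^ (1 - α)) / (κ * (α - 1)) := by
  unfold phiR
  rw [max_self, max_eq_left hq.le, Real.one_rpow]
  have : α - 1 ≠ 0 := by linarith
  field_simp
  ring

lemma seg_upper {d : ℕ} {μ f : EuclideanSpace ℝ (Fin d) → ℝ} {α κ q : ℝ} (hα : 1 < α)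
    (hκ : 0 < κ) (hq : 1 < q) (z v : EuclideanSpace ℝ (Fin d)) (hv : μ v = q - 1)
    (hf : ∀ t ∈ Set.Ioo (0:ℝ) 1, f (z + t • v) = (1 + t * (q - 1)) ^ α * κ) :
    Dmet μ f z (z + v) ≤ ENNReal.ofReal ((1 - q ^ (1 - α)) / (κ * (α - 1))) := by
  have h1 : Dmet μ f z (z + v) ≤ segLen μ f z (z + v) := by
    unfold Dmet
    refine (iInf_le _ 1).trans ((iInf_le _ ![z, z + v]).trans ?_)
    refine (iInf_le _ (by simp)).trans ((iInf_le _ (by simp)).trans ?_)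
    simp
  refine h1.trans (le_of_eq ?_)
  unfold segLen
  rw [add_sub_cancel_left, hv]
  have hpos : ∀ t ∈ Set.Icc (0:ℝ) 1, 0 < 1 + t * (q - 1) := by
    intro t ht
    have : 0 ≤ t * (q - 1) := mul_nonneg ht.1 (by linarith)
    linarith
  have e1 : ∫⁻ t in Set.Ioo (0 : ℝ) 1, ENNReal.ofReal ((f (z + t • v))⁻¹) =
      ∫⁻ t in Set.Ioo (0 : ℝ) 1, ENNReal.ofReal ((1 + t * (q - 1)) ^ (-α) / κ) := by
    refine setLIntegral_congr_fun measurableSet_Ioo fun t ht => ?_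
    rw [hf t ht, mul_inv, Real.rpow_neg (hpos t ⟨ht.1.le, ht.2.le⟩).le, div_eq_mul_inv]
  have hcont : ContinuousOn (fun t : ℝ => (1 + t * (q - 1)) ^ (-α) / κ) (Set.Icc 0 1) := by
    refine ContinuousOn.div_const (ContinuousOn.rpow_const (by fun_prop) ?_) _
    intro t ht; left; exact (hpos t ht).ne'
  have hint : IntervalIntegrable (fun t : ℝ => (1 + t * (q - 1)) ^ (-α) / κ) volume 0 1 := by
    apply ContinuousOn.intervalIntegrable
    rwa [Set.uIcc_of_le zero_le_one]
  rw [e1, ← ofReal_integral_eq_lintegral_ofReal, ← ENNReal.ofReal_mul (by linarith)]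
  · congr 1
    rw [← integral_Ioc_eq_integral_Ioo, ← intervalIntegral.integral_of_le zero_le_one,
      ← intervalIntegral.integral_const_mul]
    have : ∫ t in (0:ℝ)..1, (q - 1) * ((1 + t * (q - 1)) ^ (-α) / κ) =
        -((1 + 1 * (q - 1)) ^ (1 - α) / (κ * (α - 1))) -
         -((1 + 0 * (q - 1)) ^ (1 - α) / (κ * (α - 1))) := by
      refine intervalIntegral.integral_eq_sub_of_hasDerivAt
        (f := fun t => -((1 + t * (q - 1)) ^ (1 - α) / (κ * (α - 1)))) ?_ (hint.const_mul _)
      intro t ht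
      rw [Set.uIcc_of_le zero_le_one] at ht
      have d1 : HasDerivAt (fun t : ℝ => 1 + t * (q - 1)) (q - 1) t := by
        simpa using ((hasDerivAt_id t).mul_const (q - 1)).const_add 1
      have d2 := ((d1.rpow_const (p := 1 - α) (Or.inl (hpos t ht).ne')).div_const
        (κ * (α - 1))).neg
      refine HasDerivAt.congr_deriv (f' := -((q - 1) * (1 - α) * (1 + t * (q - 1)) ^ (1 - α - 1) /
        (κ * (α - 1)))) d2 ?_
      rw [show 1 - α - 1 = -α by ring]
      have : α - 1 ≠ 0 := by linarith
      field_simp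
      ring
    rw [this, zero_mul, one_mul, add_zero, add_sub_cancel, Real.one_rpow, sub_div]
    ring
  · have := hint.1
    exact this.mono_set Set.Ioo_subset_Ioc_self
  · refine (ae_restrict_iff' measurableSet_Ioo).mpr (Filter.Eventually.of_forall fun t ht => ?_)
    have := hpos t ⟨ht.1.le, ht.2.le⟩
    simp only [Pi.zero_apply]
    positivity

theorem stmt11 (d : ℕ) (hd : 0 < d)
    (μ : EuclideanSpace ℝ (Fin d) → ℝ)
    (hμ_add : ∀ z w, μ (z + w) ≤ μ z + μ w)
    (hμ_smul : ∀ (c : ℝ) z, μ (c • z) = |c| * μ z)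
    (hμ_eq : ∀ z, μ z = 0 ↔ z = 0)
    (ρ : ℝ) (hρ : IsLUB {r : ℝ | ∃ z : EuclideanSpace ℝ (Fin d), z ≠ 0 ∧ r = ‖z‖ / μ z} ρ)
    (x : EuclideanSpace ℝ (Fin d)) (hx1 : μ x = 1) (hx2 : ‖x‖ = ρ)
    (s : ℝ) (hs : 1 < s)
    (Q : Set (EuclideanSpace ℝ (Fin d)))
    (hQplane : ∀ z ∈ Q, ⟪z, x⟫ = 0)
    (hQcomp : IsCompact Q) (hQconv : Convex ℝ Q)
    (hQsymm : ∀ z ∈ Q, -z ∈ Q)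
    (hQball : ∀ z : EuclideanSpace ℝ (Fin d), ‖z‖ ≤ ρ → ⟪z, x⟫ = 0 → z ∈ Q)
    (Qs : Set (EuclideanSpace ℝ (Fin d)))
    (hQs : Qs = {y | ∃ z ∈ Q, ∃ t ∈ Set.Icc (-1 : ℝ) 1, y = s • z + t • x})
    (Px Pnx : Set (EuclideanSpace ℝ (Fin d)))
    (hPx : Px = {z | ⟪z - x, x⟫ = 0}) (hPnx : Pnx = {z | ⟪z + x, x⟫ = 0})
    (α : ℝ) (hα : 1 < α)
    (fs : EuclideanSpace ℝ (Fin d) → ℝ) (K : NNReal)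
    (hfsLip : LipschitzOnWith K fs (frontier Qs))
    (hfspos : ∀ z ∈ frontier Qs, 0 < fs z)
    (κ : ℝ) (hκ : IsLUB (fs '' frontier Qs) κ)
    (hfsflat : ∀ z ∈ frontier Qs ∩ (Px ∪ Pnx), fs z = κ)
    (f : EuclideanSpace ℝ (Fin d) → ℝ) (hf0 : f 0 = 0)
    (hf : ∀ z : EuclideanSpace ℝ (Fin d), z ≠ 0 →
      f z = gauge Qs z ^ α * fs ((gauge Qs z)⁻¹ • z))
    (q : ℝ) (hq : 1 < q) :
    (⨅ (z ∈ frontier Qs) (w ∈ q • frontier Qs), Dmet μ f z w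
        = ENNReal.ofReal ((1 - q ^ (1 - α)) / (κ * (α - 1)))) ∧
    (∀ z ∈ frontier Qs ∩ Px,
        Dmet μ f z (z + (q - 1) • x) = ENNReal.ofReal ((1 - q ^ (1 - α)) / (κ * (α - 1)))) ∧
    (∀ z ∈ frontier Qs ∩ Pnx,
        Dmet μ f z (z - (q - 1) • x) = ENNReal.ofReal ((1 - q ^ (1 - α)) / (κ * (α - 1)))) ∧
    (∀ z ∈ frontier Qs, ∀ w ∈ q • frontier Qs,
        Dmet μ f z w = ENNReal.ofReal ((1 - q ^ (1 - α)) / (κ * (α - 1))) →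
        z ∈ Px ∪ Pnx ∧ (w = z + (q - 1) • x ∨ w = z - (q - 1) • x)) := by
  obtain ⟨τ, u, G, hfr, hPx', hPnx', τx⟩ := geo_facts d μ hμ_add hμ_smul hμ_eq ρ hρ x hx1 hx2 s hs Q
    hQplane hQcomp hQconv hQsymm hQball Qs hQs Px Pnx hPx hPnx α hα fs hfspos κ hκ hfsflat f hf
  have hκ0 := G.hκ
  have hqf : ∀ w, w ∈ q • frontier Qs ↔ gauge Qs w = q := by
    intro w
    rw [Set.mem_smul_set_iff_inv_smul_mem₀ (by linarith), hfr, gauge_smul_of_nonneg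
      (inv_nonneg.mpr (by linarith)), smul_eq_mul, inv_mul_eq_iff_eq_mul₀ (by linarith), mul_one]
  have hlow : ∀ z w, gauge Qs z = 1 → gauge Qs w = q →
      ENNReal.ofReal ((1 - q ^ (1 - α)) / (κ * (α - 1))) ≤ Dmet μ f z w := by
    intro z w hz hw
    have := G.base z w
    rwa [hz, hw, L_eq hα hκ0 hq] at this
  -- points on the rays
  have hray : ∀ σ : ℝ, |σ| = 1 → ∀ z, gauge Qs z = 1 → τ z = σ → ∀ r : ℝ, 1 ≤ r →
      gauge Qs (z + (r - 1) • (σ • x)) = r ∧ τ (z + (r - 1) • (σ • x)) = r * σ := by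
    intro σ hσ z hz hτz r hr
    have ht : τ (z + (r - 1) • (σ • x)) = r * σ := by
      simp only [map_add, map_smul, smul_eq_mul, τx, hτz]; ring
    refine ⟨?_, ht⟩
    apply le_antisymm
    · refine (G.ν_le _).trans (max_le ?_ ?_)
      · rw [ht, abs_mul, hσ, abs_of_pos (by linarith), mul_one]
      · have e : z + (r - 1) • (σ • x) - τ (z + (r - 1) • (σ • x)) • x = z - τ z • x := by
          rw [ht, hτz]; module
        simp only [e]
        exact (G.νp_le z).trans (by rw [hz]; exact hr)
    · have := G.τ_le (z + (r - 1) • (σ • x))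
      rwa [ht, abs_mul, hσ, abs_of_pos (by linarith), mul_one] at this
  have hup : ∀ σ : ℝ, |σ| = 1 → ∀ z, gauge Qs z = 1 → τ z = σ →
      Dmet μ f z (z + (q - 1) • (σ • x)) = ENNReal.ofReal ((1 - q ^ (1 - α)) / (κ * (α - 1))) := by
    intro σ hσ z hz hτz
    apply le_antisymm
    · apply seg_upper hα hκ0 hq
      · rw [hμ_smul, hμ_smul, hσ, hx1, abs_of_pos (by linarith)]; ring
      · intro t ht
        have hr : 1 ≤ 1 + t * (q - 1) := by
          have : 0 ≤ t * (q - 1) := mul_nonneg ht.1.le (by linarith)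
          linarith
        have e : z + t • (q - 1) • (σ • x) = z + ((1 + t * (q - 1)) - 1) • (σ • x) := by module
        rw [e]
        obtain ⟨g1, g2⟩ := hray σ hσ z hz hτz _ hr
        set r := 1 + t * (q - 1)
        set y := z + (r - 1) • (σ • x)
        have hy0 : y ≠ 0 := by
          intro h; rw [h, gauge_zero] at g1; linarith
        rw [hf y hy0, g1]
        congr 1
        apply hfsflat
        refine ⟨?_, ?_⟩
        · rw [hfr, gauge_smul_of_nonneg (inv_nonneg.mpr (by linarith)), g1, smul_eq_mul,
            inv_mul_cancel₀ (by linarith)]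
        · have : τ (r⁻¹ • y) = σ := by
            rw [map_smul, g2, smul_eq_mul, inv_mul_cancel_left₀ (by linarith)]
          rcases (abs_eq zero_le_one).mp hσ with h | h
          · left; rw [hPx', this, h]
          · right; rw [hPnx', this, h]
    · exact hlow _ _ hz (hray σ hσ z hz hτz q hq.le).1
  have hplus : ∀ z ∈ frontier Qs ∩ Px,
        Dmet μ f z (z + (q - 1) • x) = ENNReal.ofReal ((1 - q ^ (1 - α)) / (κ * (α - 1))) := by
    rintro z ⟨hz, hz'⟩
    have := hup 1 (by simp) z ((hfr z).mp hz) ((hPx' z).mp hz')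
    rwa [one_smul] at this
  refine ⟨?_, hplus, ?_, ?_⟩
  · apply le_antisymm
    · have hgx : gauge Qs x = 1 := by
        apply le_antisymm
        · refine (G.ν_le x).trans (max_le ?_ ?_)
          · rw [τx, abs_one]
          · simp [τx]
        · have := G.τ_le x
          rwa [τx, abs_one] at this
      have hxm : x ∈ frontier Qs ∩ Px := ⟨(hfr x).mpr hgx, (hPx' x).mpr τx⟩
      have hw : x + (q - 1) • x ∈ q • frontier Qs := by
        rw [hqf]
        have := (hray 1 (by simp) x hgx τx q hq.le).1
        rwa [one_smul] at this
      exact ((iInf₂_le x hxm.1).trans (iInf₂_le _ hw)).trans (hplus x hxm).le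
    · refine le_iInf₂ fun z hz => le_iInf₂ fun w hw => ?_
      exact hlow z w ((hfr z).mp hz) ((hqf w).mp hw)
  · rintro z ⟨hz, hz'⟩
    have := hup (-1) (by simp) z ((hfr z).mp hz) ((hPnx' z).mp hz')
    rwa [neg_one_smul, smul_neg, ← sub_eq_add_neg] at this
  · intro z hz w hw hD
    rw [hfr] at hz
    rw [hqf] at hw
    have hD' : Dmet μ f z w ≤ ENNReal.ofReal (phiR α κ q - phiR α κ 1) := by
      rw [L_eq hα hκ0 hq]; exact hD.le
    have hp := G.perp hq hz hw hD'
    have htw : |τ w| = q := by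
      apply le_antisymm
      · exact (G.τ_le w).trans hw.le
      · have h1 := G.ν_le w
        simp only [hp] at h1
        have h2 := G.νp_le z
        simp only [hz] at h2
        rw [hw] at h1
        rcases le_max_iff.mp h1 with h | h
        · exact h
        · linarith
    have htz := abs_le.mp ((G.τ_le z).trans hz.le)
    have hwz : w = z + (τ w - τ z) • x := by
      have : w = (w - τ w • x) + τ w • x := by abel
      rw [this, hp]
      simp only [map_add, map_sub, map_smul, τx, smul_eq_mul]
      module
    rcases (abs_eq (by linarith)).mp htw with h | h
    · have h3 := G.strip hq hz hw 1 (by simp) (by rw [one_mul, h]) hD'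
      have h4 : τ z = 1 := by linarith
      refine ⟨Or.inl ((hPx' z).mpr h4), Or.inl ?_⟩
      rw [hwz]
      simp only [h4, h, map_add, map_smul, τx, smul_eq_mul]
    · have h3 := G.strip hq hz hw (-1) (by simp) (by rw [h]; ring) hD'
      have h4 : τ z = -1 := by linarith
      refine ⟨Or.inr ((hPnx' z).mpr h4), Or.inr ?_⟩
      rw [h4, h] at hwz
      rw [hwz]
      module
end

section
/- For q > 1 set K_q := { z + (q−1)·x : z ∈ P_x ∩ ∂Q_s } ∪ { z − (q−1)·x : z ∈ P_{−x} ∩ ∂Q_s }. Then for all q₂ > q₁ > 1 and every ε > 0, there exists δ > 0 (depending on f, q₁, q₂, ε) such that for every q ∈ [q₁, q₂] and every w ∈ q·∂Q_s whose Euclidean distance to K_q is at least ε, one has D(w, ∂Q_s) := inf{ D(w,z) : z ∈ ∂Q_s } ≥ (1 − q^{1−α})/(κ̄_s·(α−1)) + δ. -/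
open MeasureTheory Metric
open scoped ENNReal NNReal Pointwise RealInnerProductSpace

noncomputable def FF (κ α r : ℝ) : ℝ := (1 - (max r 1) ^ (1 - α)) / (κ * (α - 1))
noncomputable def GG (κ α r : ℝ) : ℝ := (max r 1) ^ (-α) / κ

lemma GG_pos {κ α : ℝ} (hκ : 0 < κ) (r : ℝ) : 0 < GG κ α r := by
  unfold GG
  have : 0 < max r 1 := lt_of_lt_of_le one_pos (le_max_right _ _)
  positivity

lemma GG_anti {κ α : ℝ} (hκ : 0 < κ) (hα : 1 < α) {r r' : ℝ} (h : r ≤ r') :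
    GG κ α r' ≤ GG κ α r := by
  unfold GG
  have h1 : 0 < max r 1 := lt_of_lt_of_le one_pos (le_max_right _ _)
  apply div_le_div_of_nonneg_right _ hκ.le
  exact Real.rpow_le_rpow_of_nonpos h1 (max_le_max_right 1 h) (by linarith)

lemma GG_cont {κ α : ℝ} : Continuous (GG κ α) := by
  unfold GG
  apply Continuous.div_const
  apply Continuous.rpow_const (by fun_prop)
  intro r; left
  have : 0 < max r 1 := lt_of_lt_of_le one_pos (le_max_right _ _)
  exact this.ne'

lemma FF_mono {κ α : ℝ} (hκ : 0 < κ) (hα : 1 < α) {r r' : ℝ} (h : r ≤ r') :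
    FF κ α r ≤ FF κ α r' := by
  unfold FF
  have h1 : 0 < max r 1 := lt_of_lt_of_le one_pos (le_max_right _ _)
  have : 0 < α - 1 := by linarith
  apply div_le_div_of_nonneg_right _ (by positivity)
  have := Real.rpow_le_rpow_of_nonpos h1 (max_le_max_right 1 h) (show 1 - α ≤ 0 by linarith)
  linarith

lemma FF_lt {κ α : ℝ} (hκ : 0 < κ) (hα : 1 < α) {r r' : ℝ} (h1 : 1 ≤ r) (h : r < r') :
    FF κ α r < FF κ α r' := by
  unfold FF
  have : 0 < α - 1 := by linarith
  rw [max_eq_left h1, max_eq_left (h1.trans h.le)]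
  apply div_lt_div_of_pos_right _ (by positivity)
  have := Real.rpow_lt_rpow_of_neg (by linarith) h (show 1 - α < 0 by linarith)
  linarith

lemma FF_one {κ α : ℝ} : FF κ α 1 = 0 := by simp [FF]

lemma FF_sub {κ α : ℝ} (hκ : 0 < κ) (hα : 1 < α) {r r' : ℝ} (h : r ≤ r') :
    FF κ α r' - FF κ α r ≤ GG κ α r * (r' - r) := by
  unfold FF GG
  set p := max r 1 with hp
  set p' := max r' 1 with hp'
  have h1 : 0 < p := lt_of_lt_of_le one_pos (le_max_right _ _)
  have h1' : 0 < p' := lt_of_lt_of_le one_pos (le_max_right _ _)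
  have hpp : p' - p ≤ r' - r := by
    rw [hp, hp']
    rcases le_total r 1 with a | a <;> rcases le_total r' 1 with b | b <;> simp [a, b] <;> linarith
  have hα' : 0 < α - 1 := by linarith
  have key : p ^ (1 - α) - p' ^ (1 - α) ≤ (α - 1) * p ^ (-α) * (p' - p) := by
    have e1 : p' ^ (1 - α) = p ^ (1 - α) * (p' / p) ^ (1 - α) := by
      rw [← Real.mul_rpow h1.le (by positivity)]
      congr 1; field_simp
    have e2 : 1 + (1 - α) * (p' / p - 1) ≤ (p' / p) ^ (1 - α) := by
      rw [Real.rpow_def_of_pos (by positivity)]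
      have := Real.add_one_le_exp (Real.log (p' / p) * (1 - α))
      have := Real.log_le_sub_one_of_pos (show 0 < p' / p by positivity)
      nlinarith
    have e3 : p ^ (-α) = p ^ (1 - α) / p := by
      rw [← Real.rpow_sub_one h1.ne']; congr 1; ring
    rw [e1, e3]
    have hq : 0 < p ^ (1 - α) := by positivity
    have e4 : (α - 1) * (p ^ (1 - α) / p) * (p' - p) = p ^ (1 - α) * ((α - 1) * (p' / p - 1)) := by
      field_simp
    rw [e4]
    nlinarith
  have hpa : 0 < p ^ (-α) := by positivity
  calc _ = (p ^ (1 - α) - p' ^ (1 - α)) / (κ * (α - 1)) := by ring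
    _ ≤ ((α - 1) * p ^ (-α) * (p' - p)) / (κ * (α - 1)) := by gcongr
    _ = p ^ (-α) / κ * (p' - p) := by field_simp
    _ ≤ _ := by gcongr

noncomputable def PP (κ α σ R η n b : ℝ) : ℝ :=
  min ((1 - σ ^ 2) * FF κ α n + σ * GG κ α R * min (max b 1) (1 + η))
    ((1 - σ ^ 2) * FF κ α R + σ * GG κ α R)

set_option maxHeartbeats 1000000 in
lemma PP_step {κ α σ R η s : ℝ} (hκ : 0 < κ) (hα : 1 < α) (hσ : 0 < σ) (hσ1 : σ < 1)
    (hs : 1 + σ ≤ s) (hη : 0 < η)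
    {n1 n2 b1 b2 m A B : ℝ} (hA : 0 ≤ A) (hB : 0 ≤ B) (hm : 0 ≤ m)
    (hn : |n1 - n2| ≤ max A B) (hb : |b1 - b2| ≤ B)
    (hab : A ^ 2 + s ^ 2 * B ^ 2 ≤ m ^ 2) :
    PP κ α σ R η n1 b1 - PP κ α σ R η n2 b2 ≤ GG κ α (min n1 n2) * m := by
  have hG := GG_pos (α := α) hκ (min n1 n2)
  have hGR := GG_pos (α := α) hκ R
  have hσ2 : 0 < 1 - σ ^ 2 := by nlinarith
  have hψ : ∀ b, 1 ≤ min (max b 1) (1 + η) := fun b => le_min (le_max_right _ _) (by linarith)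
  have hAm : A ≤ m := by nlinarith [sq_nonneg (s * B)]
  have hsB : s * B ≤ m := by
    apply abs_le_of_sq_le_sq' _ hm |>.2
    nlinarith [sq_nonneg A]
  have hBm : B ≤ m := by nlinarith
  have hmax : max A B ≤ m := max_le hAm hBm
  have hcomb : (1 - σ ^ 2) * max A B + σ * B ≤ m := by
    rcases le_total A B with h | h
    · rw [max_eq_right h]; nlinarith [sq_nonneg σ, mul_nonneg (sq_nonneg σ) hB]
    · rw [max_eq_left h]
      apply abs_le_of_sq_le_sq' _ hm |>.2
      have h1 : A ^ 2 + B ^ 2 ≤ m ^ 2 := by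
        have : 1 ≤ s ^ 2 := by nlinarith
        nlinarith [sq_nonneg B]
      have h2 : ((1 - σ ^ 2) * A + σ * B) ^ 2 ≤ ((1 - σ ^ 2) ^ 2 + σ ^ 2) * (A ^ 2 + B ^ 2) := by
        nlinarith [sq_nonneg ((1 - σ ^ 2) * B - σ * A)]
      have h3 : (1 - σ ^ 2) ^ 2 + σ ^ 2 ≤ 1 := by nlinarith [sq_nonneg σ]
      nlinarith [sq_nonneg A, sq_nonneg B]
  have hR0 : 0 ≤ GG κ α (min n1 n2) * m := by positivity
  have hFd : FF κ α n1 - FF κ α n2 ≤ GG κ α (min n1 n2) * max A B := by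
    rcases le_total n1 n2 with h | h
    · have := FF_mono hκ hα h
      have : 0 ≤ GG κ α (min n1 n2) * max A B := by positivity
      linarith
    · have := FF_sub hκ hα h
      rw [min_eq_right h] at *
      have h2 := (le_abs_self _).trans hn
      nlinarith
  unfold PP
  set M := (1 - σ ^ 2) * FF κ α R + σ * GG κ α R with hM
  set X1 := (1 - σ ^ 2) * FF κ α n1 + σ * GG κ α R * min (max b1 1) (1 + η) with hX1
  set X2 := (1 - σ ^ 2) * FF κ α n2 + σ * GG κ α R * min (max b2 1) (1 + η) with hX2
  rcases le_total M X2 with h2 | h2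
  · rw [min_eq_right h2]
    have := min_le_right X1 M
    linarith
  rw [min_eq_left h2]
  have hc := hψ b2
  have hσG : 0 < σ * GG κ α R := by positivity
  rcases le_or_gt R n1 with h1 | h1
  · have := min_le_right X1 M
    have h3 := FF_mono hκ hα h1
    have h5 : M - X2 ≤ (1 - σ ^ 2) * (FF κ α n1 - FF κ α n2) := by
      rw [hM, hX2]; nlinarith
    have h6 : (1 - σ ^ 2) * (GG κ α (min n1 n2) * max A B) ≤ GG κ α (min n1 n2) * m := by
      have : 0 ≤ σ * B := by positivity
      nlinarith
    have h7 := mul_le_mul_of_nonneg_left hFd hσ2.le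
    linarith
  · have := min_le_left X1 M
    have h3 := GG_anti hκ hα ((min_le_left n1 n2).trans h1.le)
    have h4 : min (max b1 1) (1 + η) - min (max b2 1) (1 + η) ≤ B := by
      have := (le_abs_self _).trans hb
      have h5 : max b1 1 ≤ max b2 1 + B := max_le (by linarith [le_max_left b2 1]) (by linarith [le_max_right b2 1])
      have : min (max b1 1) (1 + η) ≤ min (max b2 1) (1 + η) + B := by
        rw [← min_add_add_right]
        exact min_le_min h5 (by linarith)
      linarith
    have h5 : X1 - X2 ≤ (1 - σ ^ 2) * (FF κ α n1 - FF κ α n2) + σ * GG κ α R * B := by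
      rw [hX1, hX2]; nlinarith
    have h6 : σ * GG κ α R * B ≤ σ * GG κ α (min n1 n2) * B := by gcongr
    have h7 := mul_le_mul_of_nonneg_left hFd hσ2.le
    have h8 := mul_le_mul_of_nonneg_left hcomb hG.le
    linarith

lemma seg_int {φ n : ℝ → ℝ} {G : ℝ → ℝ} (hG : Continuous G) {m : ℝ} (hφ : Continuous φ)
    (hn : Continuous n)
    (h : ∀ t t', t < t' → φ t' - φ t ≤ G (min (n t') (n t)) * (m * (t' - t))) :
    φ 1 - φ 0 ≤ m * ∫ t in (0:ℝ)..1, G (n t) := by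
  have hc : Continuous fun t => G (n t) := hG.comp hn
  have hB : ∀ t, HasDerivAt (fun t => φ 0 + m * ∫ u in (0:ℝ)..t, G (n u)) (m * G (n t)) t := by
    intro t
    exact ((hc.integral_hasStrictDerivAt 0 t).hasDerivAt.const_mul m).const_add _
  have := image_le_of_liminf_slope_right_le_deriv_boundary (f := φ) (a := 0) (b := 1)
    (B := fun t => φ 0 + m * ∫ u in (0:ℝ)..t, G (n u)) (B' := fun t => m * G (n t))
    hφ.continuousOn (by simp) (fun t _ => (hB t).continuousAt.continuousWithinAt)
    (fun t _ => (hB t).hasDerivWithinAt) ?_ (show (1:ℝ) ∈ Set.Icc (0:ℝ) 1 by simp)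
  · linarith
  · intro t _ r hr
    apply Filter.Eventually.frequently
    have hcont : Continuous fun z => G (min (n z) (n t)) * m := by fun_prop
    have h1 : ∀ᶠ z in nhds t, G (min (n z) (n t)) * m < r := by
      apply hcont.continuousAt.eventually_lt continuousAt_const
      simp; linarith
    filter_upwards [nhdsWithin_le_nhds h1, self_mem_nhdsWithin] with z hz hz'
    have hz' : 0 < z - t := sub_pos.2 hz'
    rw [slope_def_field, div_lt_iff₀ hz']
    have := h t z (by linarith)
    nlinarith

lemma seg_le {d : ℕ} {μ f ν Φ : EuclideanSpace ℝ (Fin d) → ℝ} {G : ℝ → ℝ}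
    (hG : Continuous G) (hG0 : ∀ r, 0 ≤ G r) (hμ0 : ∀ z, 0 ≤ μ z)
    (hμ_smul : ∀ (c : ℝ) z, μ (c • z) = |c| * μ z)
    (hν : Continuous ν) (hΦ : Continuous Φ)
    (hstep : ∀ u v, Φ u - Φ v ≤ G (min (ν u) (ν v)) * μ (u - v))
    (hfG : ∀ z, z ≠ 0 → G (ν z) ≤ (f z)⁻¹) (u v : EuclideanSpace ℝ (Fin d)) :
    ENNReal.ofReal (Φ u - Φ v) ≤ segLen μ f u v := by
  rcases eq_or_ne u v with rfl | huv
  · simp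
  have hneg : ∀ z, μ (-z) = μ z := by
    intro z; have := hμ_smul (-1) z; simpa using this
  let γ : ℝ → EuclideanSpace ℝ (Fin d) := fun t => u + t • (v - u)
  have hγ : Continuous γ := by fun_prop
  have hc : Continuous fun t => G (ν (γ t)) := hG.comp (hν.comp hγ)
  have key := seg_int (φ := fun t => - Φ (γ t)) (n := fun t => ν (γ t)) hG (m := μ (v - u))
    (hΦ.comp hγ).neg (hν.comp hγ) (by
      intro t t' htt
      have h1 := hstep (γ t) (γ t')
      have h2 : γ t - γ t' = -((t' - t) • (v - u)) := by
        simp only [γ]; module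
      rw [h2, hneg, hμ_smul, abs_of_pos (sub_pos.2 htt), min_comm] at h1
      linarith)
  have e1 : γ 1 = v := by simp [γ]
  have e0 : γ 0 = u := by simp [γ]
  simp only [e1, e0] at key
  have h3 : Φ u - Φ v ≤ μ (v - u) * ∫ t in (0:ℝ)..1, G (ν (γ t)) := by linarith
  refine (ENNReal.ofReal_le_ofReal h3).trans ?_
  rw [ENNReal.ofReal_mul (hμ0 _)]
  unfold segLen
  gcongr
  rw [intervalIntegral.integral_of_le zero_le_one, integral_Ioc_eq_integral_Ioo,
    ofReal_integral_eq_lintegral_ofReal]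
  · apply lintegral_mono_ae
    apply ae_restrict_of_ae
    have hsub : {t : ℝ | γ t = 0}.Subsingleton := by
      intro a ha b hb
      have : (a - b) • (v - u) = 0 := by
        have ha' : u + a • (v - u) = 0 := ha
        have hb' : u + b • (v - u) = 0 := hb
        have : (a - b) • (v - u) = (u + a • (v - u)) - (u + b • (v - u)) := by module
        rw [this, ha', hb', sub_zero]
      rcases smul_eq_zero.1 this with h | h
      · linarith
      · exact absurd (sub_eq_zero.1 h).symm huv
    have hz := hsub.finite.measure_zero volume
    have : ∀ᵐ t : ℝ, ¬ γ t = 0 := by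
      rw [ae_iff]; simpa using hz
    filter_upwards [this] with t ht
    exact ENNReal.ofReal_le_ofReal (hfG _ ht)
  · exact (hc.continuousOn.integrableOn_Icc (a := 0) (b := 1)).mono_set Set.Ioo_subset_Icc_self
  · exact Filter.Eventually.of_forall fun t => hG0 _

lemma path_le {d : ℕ} {μ f Φ : EuclideanSpace ℝ (Fin d) → ℝ}
    (h : ∀ u v, ENNReal.ofReal (Φ u - Φ v) ≤ segLen μ f u v) (z w : EuclideanSpace ℝ (Fin d)) :
    ENNReal.ofReal (Φ z - Φ w) ≤ Dmet μ f z w := by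
  unfold Dmet
  have key : ∀ (n : ℕ) (p : Fin (n + 1) → EuclideanSpace ℝ (Fin d)),
      ENNReal.ofReal (Φ (p 0) - Φ (p (Fin.last n))) ≤
        ∑ i : Fin n, segLen μ f (p i.castSucc) (p i.succ) := by
    intro n
    induction n with
    | zero => intro p; simp
    | succ k ih =>
      intro p
      rw [Fin.sum_univ_castSucc]
      have h1 := ih (fun i => p i.castSucc)
      have h2 := h (p (Fin.last k).castSucc) (p (Fin.last k).succ)
      calc _ = ENNReal.ofReal ((Φ (p 0) - Φ (p (Fin.last k).castSucc)) +
            (Φ (p (Fin.last k).castSucc) - Φ (p (Fin.last (k+1))))) := by congr 1; ring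
        _ ≤ _ := ENNReal.ofReal_add_le
        _ ≤ _ := add_le_add h1 h2
  refine le_iInf fun n => le_iInf fun p => le_iInf fun h0 => le_iInf fun h1 => ?_
  rw [← h0, ← h1]
  exact key n p

lemma gauge_abs_sub {E : Type*} [AddCommGroup E] [Module ℝ E] {C : Set E} (hc : Convex ℝ C)
    (ha : Absorbent ℝ C) (hsymm : ∀ z ∈ C, -z ∈ C) (u v : E) :
    |gauge C u - gauge C v| ≤ gauge C (u - v) := by
  have h1 := gauge_add_le hc ha (u - v) v
  have h2 := gauge_add_le hc ha (-(u - v)) u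
  rw [gauge_neg hsymm] at h2
  simp only [sub_add_cancel, neg_sub] at h1 h2
  rw [abs_le]; constructor <;> linarith

theorem stmt12 (d : ℕ) (hd : 0 < d)
    (μ : EuclideanSpace ℝ (Fin d) → ℝ)
    (hμ_add : ∀ z w, μ (z + w) ≤ μ z + μ w)
    (hμ_smul : ∀ (c : ℝ) z, μ (c • z) = |c| * μ z)
    (hμ_eq : ∀ z, μ z = 0 ↔ z = 0)
    (ρ : ℝ) (hρ : IsLUB {r : ℝ | ∃ z : EuclideanSpace ℝ (Fin d), z ≠ 0 ∧ r = ‖z‖ / μ z} ρ)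
    (x : EuclideanSpace ℝ (Fin d)) (hx1 : μ x = 1) (hx2 : ‖x‖ = ρ)
    (s : ℝ) (hs : 1 < s)
    (Q : Set (EuclideanSpace ℝ (Fin d)))
    (hQplane : ∀ z ∈ Q, ⟪z, x⟫ = 0)
    (hQcomp : IsCompact Q) (hQconv : Convex ℝ Q)
    (hQsymm : ∀ z ∈ Q, -z ∈ Q)
    (hQball : ∀ z : EuclideanSpace ℝ (Fin d), ‖z‖ ≤ ρ → ⟪z, x⟫ = 0 → z ∈ Q)
    (Qs : Set (EuclideanSpace ℝ (Fin d)))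
    (hQs : Qs = {y | ∃ z ∈ Q, ∃ t ∈ Set.Icc (-1 : ℝ) 1, y = s • z + t • x})
    (Px Pnx : Set (EuclideanSpace ℝ (Fin d)))
    (hPx : Px = {z | ⟪z - x, x⟫ = 0}) (hPnx : Pnx = {z | ⟪z + x, x⟫ = 0})
    (α : ℝ) (hα : 1 < α)
    (fs : EuclideanSpace ℝ (Fin d) → ℝ) (K : NNReal)
    (hfsLip : LipschitzOnWith K fs (frontier Qs))
    (hfspos : ∀ z ∈ frontier Qs, 0 < fs z)
    (κ : ℝ) (hκ : IsLUB (fs '' frontier Qs) κ)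
    (hfsflat : ∀ z ∈ frontier Qs ∩ (Px ∪ Pnx), fs z = κ)
    (f : EuclideanSpace ℝ (Fin d) → ℝ) (hf0 : f 0 = 0)
    (hf : ∀ z : EuclideanSpace ℝ (Fin d), z ≠ 0 →
      f z = gauge Qs z ^ α * fs ((gauge Qs z)⁻¹ • z))
    (Kq : ℝ → Set (EuclideanSpace ℝ (Fin d)))
    (hKq : ∀ q : ℝ, Kq q = (fun z => z + (q - 1) • x) '' (Px ∩ frontier Qs) ∪
        (fun z => z - (q - 1) • x) '' (Pnx ∩ frontier Qs)) :
    ∀ q₁ q₂ : ℝ, 1 < q₁ → q₁ < q₂ → ∀ ε : ℝ, 0 < ε →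
      ∃ δ : ℝ, 0 < δ ∧ ∀ q ∈ Set.Icc q₁ q₂, ∀ w ∈ q • frontier Qs,
        (∀ y ∈ Kq q, ε ≤ dist w y) →
        ENNReal.ofReal ((1 - q ^ (1 - α)) / (κ * (α - 1)) + δ) ≤
          ⨅ z ∈ frontier Qs, Dmet μ f w z := by
  have hx0 : x ≠ 0 := by
    rintro rfl
    rw [(hμ_eq 0).2 rfl] at hx1; norm_num at hx1
  have hρ0 : 0 < ρ := by rw [← hx2]; exact norm_pos_iff.2 hx0
  have hμneg : ∀ z, μ (-z) = μ z := by
    intro z; have := hμ_smul (-1) z; simpa using this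
  have hμ0 : ∀ z, 0 ≤ μ z := by
    intro z
    have h1 := hμ_add z (-z)
    rw [add_neg_cancel, (hμ_eq 0).2 rfl, hμneg] at h1
    linarith
  have hnorm : ∀ z, ‖z‖ ≤ ρ * μ z := by
    intro z
    rcases eq_or_ne z 0 with rfl | hz
    · simp [(hμ_eq 0).2 rfl]
    · have h1 := hρ.1 ⟨z, hz, rfl⟩
      have h2 : 0 < μ z := lt_of_le_of_ne (hμ0 z) (fun h => hz ((hμ_eq z).1 h.symm))
      rwa [div_le_iff₀ h2] at h1
  have hs0 : 0 < s := by linarith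
  have hxx : ⟪x, x⟫ = ρ ^ 2 := by rw [real_inner_self_eq_norm_sq, hx2]
  obtain ⟨h, hh⟩ : ∃ h : EuclideanSpace ℝ (Fin d) →ₗ[ℝ] ℝ, ∀ z, h z = ⟪z, x⟫ / ρ ^ 2 := by
    refine ⟨(ρ ^ 2)⁻¹ • (innerₗ (EuclideanSpace ℝ (Fin d)) x), fun z => ?_⟩
    simp [real_inner_comm, div_eq_inv_mul]
  obtain ⟨T, hT⟩ : ∃ T : EuclideanSpace ℝ (Fin d) →ₗ[ℝ] EuclideanSpace ℝ (Fin d),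
      ∀ z, T z = s⁻¹ • (z - h z • x) :=
    ⟨s⁻¹ • (LinearMap.id - h.smulRight x), fun z => by simp⟩
  have hhx : h x = 1 := by rw [hh, hxx]; field_simp
  have hTx : T x = 0 := by rw [hT, hhx]; simp
  have hTinner : ∀ z, ⟪T z, x⟫ = 0 := by
    intro z
    rw [hT, inner_smul_left, inner_sub_left, inner_smul_left, hxx, hh]
    simp; right; field_simp; simp
  have hdecomp : ∀ z, z = s • T z + h z • x := by
    intro z; rw [hT, smul_inv_smul₀ hs0.ne']; simp
  have hpyth : ∀ z, ρ ^ 2 * (h z) ^ 2 + s ^ 2 * ‖T z‖ ^ 2 = ‖z‖ ^ 2 := by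
    intro z
    conv_rhs => rw [hdecomp z]
    rw [norm_add_sq_real, norm_smul, norm_smul, inner_smul_left, inner_smul_right, hTinner, hx2,
      mul_pow, mul_pow, Real.norm_eq_abs, Real.norm_eq_abs, sq_abs, sq_abs]
    simp; ring
  have hQs' : Qs = {y | |h y| ≤ 1 ∧ T y ∈ Q} := by
    rw [hQs]; ext y; constructor
    · rintro ⟨z, hz, t, ht, rfl⟩
      have hhz : h z = 0 := by rw [hh, hQplane z hz]; simp
      have hTz : T z = s⁻¹ • z := by rw [hT, hhz]; simp
      simp only [Set.mem_setOf_eq, map_add, map_smul, hhz, hhx, hTz, hTx]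
      simp [hs0.ne', hz, abs_le]
      exact ht
    · rintro ⟨h1, h2⟩
      exact ⟨T y, h2, h y, abs_le.1 h1, hdecomp y⟩
  set C : Set (EuclideanSpace ℝ (Fin d)) := T ⁻¹' Q with hC
  have hballQs : closedBall 0 ρ ⊆ Qs := by
    intro z hz
    rw [mem_closedBall_zero_iff] at hz
    have hp := hpyth z
    rw [hQs']
    have hz2 : ‖z‖ ^ 2 ≤ ρ ^ 2 := by gcongr
    refine ⟨?_, hQball _ ?_ (hTinner z)⟩
    · rw [← sq_le_one_iff_abs_le_one]
      have h1 : ρ ^ 2 * (h z) ^ 2 ≤ ρ ^ 2 * 1 := by nlinarith [sq_nonneg (s * ‖T z‖)]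
      exact le_of_mul_le_mul_left h1 (by positivity)
    · apply abs_le_of_sq_le_sq' _ hρ0.le |>.2
      have : 1 ≤ s ^ 2 := by nlinarith
      nlinarith [sq_nonneg (ρ * h z), sq_nonneg ‖T z‖]
  have hQsC : Qs ⊆ C := by rw [hQs']; exact fun y hy => hy.2
  have hQsn : Qs ∈ nhds 0 := Filter.mem_of_superset (closedBall_mem_nhds 0 hρ0) hballQs
  have hCn : C ∈ nhds 0 := Filter.mem_of_superset hQsn hQsC
  have hCconv : Convex ℝ C := hQconv.linear_preimage T
  have hCsymm : ∀ z ∈ C, -z ∈ C := fun z hz => by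
    simp only [hC, Set.mem_preimage, map_neg] at hz ⊢; exact hQsymm _ hz
  have hQsconv : Convex ℝ Qs := by
    have : Qs = (h ⁻¹' Set.Icc (-1) 1) ∩ C := by
      rw [hQs']; ext y; simp [abs_le, hC]
    rw [this]
    exact ((convex_Icc _ _).linear_preimage h).inter hCconv
  have hQssymm : ∀ z ∈ Qs, -z ∈ Qs := fun z hz => by
    rw [hQs'] at hz ⊢
    exact ⟨by simpa using hz.1, by simpa using hQsymm _ hz.2⟩
  have hQscomp : IsCompact Qs := by
    have : Qs = (fun p : EuclideanSpace ℝ (Fin d) × ℝ => s • p.1 + p.2 • x) ''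
        (Q ×ˢ Set.Icc (-1 : ℝ) 1) := by
      rw [hQs]; ext y; constructor
      · rintro ⟨z, hz, t, ht, rfl⟩; exact ⟨(z, t), ⟨hz, ht⟩, rfl⟩
      · rintro ⟨⟨z, t⟩, ⟨hz, ht⟩, rfl⟩; exact ⟨z, hz, t, ht, rfl⟩
    rw [this]
    exact (hQcomp.prod isCompact_Icc).image (by fun_prop)
  have hQsabs : Absorbent ℝ Qs := absorbent_nhds_zero hQsn
  have hCabs : Absorbent ℝ C := absorbent_nhds_zero hCn
  have hfront : ∀ z, z ∈ frontier Qs ↔ gauge Qs z = 1 := fun z =>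
    (gauge_eq_one_iff_mem_frontier hQsconv hQsn).symm
  have hνcont : Continuous (gauge Qs) := continuous_gauge hQsconv hQsn
  have hbcont : Continuous (gauge C) := continuous_gauge hCconv hCn
  have hfQs : frontier Qs ⊆ Qs := hQscomp.isClosed.frontier_subset
  -- gauge bounds
  have hmemC : ∀ z t, 0 < t → gauge C z < t → T (t⁻¹ • z) ∈ Q := by
    intro z t ht hlt
    have : gauge C (t⁻¹ • z) < 1 := by
      rw [gauge_smul_of_nonneg (by positivity), smul_eq_mul, inv_mul_lt_iff₀ ht]; linarith
    exact setOfPred_gauge_lt_one_subset_self hCconv (mem_of_mem_nhds hCn) hCabs this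
  have hνmax : ∀ z, gauge Qs z ≤ max |h z| (gauge C z) := by
    intro z
    apply le_of_forall_gt_imp_ge_of_dense
    intro t ht
    have h1 := (le_max_left _ _).trans_lt ht
    have h2 := (le_max_right _ _).trans_lt ht
    have ht0 : 0 < t := (abs_nonneg _).trans_lt h1
    apply gauge_le_of_mem ht0.le
    rw [Set.mem_smul_set_iff_inv_smul_mem₀ ht0.ne', hQs']
    refine ⟨?_, hmemC z t ht0 h2⟩
    rw [map_smul, smul_eq_mul, abs_mul, abs_of_pos (inv_pos.2 ht0), inv_mul_le_iff₀ ht0]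
    linarith
  have hhν : ∀ z, |h z| ≤ gauge Qs z := by
    intro z
    apply le_of_forall_gt_imp_ge_of_dense
    intro t ht
    obtain ⟨r, hr0, hr, hz⟩ := exists_lt_of_gauge_lt hQsabs ht
    rw [Set.mem_smul_set_iff_inv_smul_mem₀ hr0.ne', hQs'] at hz
    have := hz.1
    rw [map_smul, smul_eq_mul, abs_mul, abs_of_pos (inv_pos.2 hr0), inv_mul_le_iff₀ hr0] at this
    linarith
  have hbT : ∀ z, gauge C z ≤ ‖T z‖ / ρ := by
    intro z
    apply le_of_forall_gt_imp_ge_of_dense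
    intro t ht
    have ht0 : 0 < t := lt_of_le_of_lt (by positivity) ht
    apply gauge_le_of_mem ht0.le
    rw [Set.mem_smul_set_iff_inv_smul_mem₀ ht0.ne']
    refine hQball _ ?_ (hTinner _)
    rw [map_smul, norm_smul, Real.norm_eq_abs, abs_of_pos (inv_pos.2 ht0), inv_mul_le_iff₀ ht0]
    rw [div_lt_iff₀ hρ0] at ht
    exact ht.le
  have hab : ∀ z, |h z| ^ 2 + s ^ 2 * gauge C z ^ 2 ≤ μ z ^ 2 := by
    intro z
    have h1 := hpyth z
    have h2 : ‖z‖ ^ 2 ≤ (ρ * μ z) ^ 2 := by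
      have := hnorm z; gcongr
    have h3 : (ρ * gauge C z) ^ 2 ≤ ‖T z‖ ^ 2 := by
      have := hbT z
      rw [le_div_iff₀ hρ0] at this
      have h0 : 0 ≤ gauge C z := gauge_nonneg z
      gcongr; linarith
    rw [sq_abs]
    have h4 : s ^ 2 * (ρ * gauge C z) ^ 2 ≤ s ^ 2 * ‖T z‖ ^ 2 := by gcongr
    have h5 : ρ ^ 2 * ((h z) ^ 2 + s ^ 2 * gauge C z ^ 2) ≤ ρ ^ 2 * μ z ^ 2 := by nlinarith
    exact le_of_mul_le_mul_left h5 (by positivity)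
  -- facts on f
  have hxQ : ∀ z, |h z| = 1 → T z ∈ Q → z ∈ frontier Qs := by
    intro z h1 h2
    rw [hfront]
    apply le_antisymm
    · exact gauge_le_one_of_mem (by rw [hQs']; exact ⟨h1.le, h2⟩)
    · rw [← h1]; exact hhν z
  have h0Q : (0 : EuclideanSpace ℝ (Fin d)) ∈ Q := hQball 0 (by simpa using hρ0.le) (by simp)
  have hxf : x ∈ frontier Qs := hxQ x (by simp [hhx]) (by rw [hTx]; exact h0Q)
  have hκ0 : 0 < κ := (hfspos x hxf).trans_le (hκ.1 ⟨x, hxf, rfl⟩)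
  have hνpos : ∀ z, z ≠ 0 → 0 < gauge Qs z := fun z hz =>
    (gauge_pos hQsabs (NormedSpace.isVonNBounded_of_isBounded ℝ hQscomp.isBounded)).2 hz
  have hfG : ∀ z, z ≠ 0 → GG κ α (gauge Qs z) ≤ (f z)⁻¹ := by
    intro z hz
    have hν := hνpos z hz
    have hfr : (gauge Qs z)⁻¹ • z ∈ frontier Qs := by
      rw [hfront, gauge_smul_of_nonneg (by positivity), smul_eq_mul, inv_mul_cancel₀ hν.ne']
    have h1 := hκ.1 ⟨_, hfr, rfl⟩
    have h2 := hfspos _ hfr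
    have h3 : 0 < gauge Qs z ^ α := by positivity
    have hm : 0 < max (gauge Qs z) 1 := lt_of_lt_of_le one_pos (le_max_right _ _)
    have : GG κ α (gauge Qs z) = (max (gauge Qs z) 1 ^ α * κ)⁻¹ := by
      unfold GG; rw [Real.rpow_neg hm.le]; field_simp
    rw [this, hf z hz]
    apply inv_anti₀ (by positivity)
    gcongr
    exact le_max_left _ _
  intro q₁ q₂ hq₁ hq₁₂ ε hε
  -- the constants
  obtain ⟨B, hB⟩ := hQcomp.isBounded.exists_norm_le
  have hB0 : 0 ≤ B := (norm_nonneg _).trans (hB 0 h0Q)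
  obtain ⟨η, hη0, hη1, hη2⟩ : ∃ η, 0 < η ∧ 1 + η ≤ q₁ ∧ η * (s * B) < ε := by
    refine ⟨min (q₁ - 1) (ε / (s * B + 1)), lt_min (by linarith) (by positivity),
      by linarith [min_le_left (q₁ - 1) (ε / (s * B + 1))], ?_⟩
    calc _ ≤ ε / (s * B + 1) * (s * B) := by gcongr; exact min_le_right _ _
      _ < ε := by rw [div_mul_eq_mul_div, div_lt_iff₀ (by positivity)]; nlinarith
  set R := q₂ + 1 with hR
  have hF2 : 0 < FF κ α q₂ := by
    rw [← FF_one (κ := κ) (α := α)]; exact FF_lt hκ0 hα le_rfl (by linarith)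
  have hFR : FF κ α q₂ < FF κ α R := FF_lt hκ0 hα (by linarith) (by linarith)
  have hGR := GG_pos (α := α) hκ0 R
  obtain ⟨σ, hσ0, hσ1, hσs, hσa, hσb⟩ : ∃ σ, 0 < σ ∧ σ < 1 ∧ 1 + σ ≤ s ∧
      0 < σ * GG κ α R * η - σ ^ 2 * FF κ α q₂ ∧ 0 < (1 - σ ^ 2) * FF κ α R - FF κ α q₂ := by
    have ev : ∀ᶠ σ : ℝ in nhdsWithin 0 (Set.Ioi 0), σ < 1 ∧ σ < s - 1 ∧
      σ * FF κ α q₂ < GG κ α R * η ∧ FF κ α q₂ < (1 - σ ^ 2) * FF κ α R := by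
      apply nhdsWithin_le_nhds
      refine Filter.Eventually.and ?_ (Filter.Eventually.and ?_ (Filter.Eventually.and ?_ ?_))
      · exact eventually_lt_nhds one_pos
      · exact eventually_lt_nhds (by linarith)
      · exact ContinuousAt.eventually_lt (by fun_prop) continuousAt_const (by simp; positivity)
      · exact ContinuousAt.eventually_lt continuousAt_const (by fun_prop) (by simpa using hFR)
    obtain ⟨σ, ⟨h1, h2, h3, h4⟩, h5⟩ := (ev.and self_mem_nhdsWithin).exists
    have h5 : 0 < σ := h5
    exact ⟨σ, h5, h1, by linarith, by nlinarith, by linarith⟩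
  set Φ : EuclideanSpace ℝ (Fin d) → ℝ := fun z => PP κ α σ R η (gauge Qs z) (gauge C z) with hΦ
  have hFcont : Continuous (FF κ α) := by
    unfold FF
    apply Continuous.div_const
    apply Continuous.sub continuous_const
    apply Continuous.rpow_const (by fun_prop)
    intro r; left
    have : 0 < max r 1 := lt_of_lt_of_le one_pos (le_max_right _ _)
    exact this.ne'
  have hΦcont : Continuous Φ := by
    rw [hΦ]; unfold PP; fun_prop
  have hstep : ∀ u v, Φ u - Φ v ≤ GG κ α (min (gauge Qs u) (gauge Qs v)) * μ (u - v) := by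
    intro u v
    refine PP_step hκ0 hα hσ0 hσ1 hσs hη0 (abs_nonneg (h (u - v)))
      (gauge_nonneg (s := C) (u - v)) (hμ0 _) ?_ ?_ (hab _)
    · exact (gauge_abs_sub hQsconv hQsabs hQssymm u v).trans (hνmax _)
    · exact gauge_abs_sub hCconv hCabs hCsymm u v
  have hD := path_le (seg_le GG_cont (fun r => (GG_pos hκ0 r).le) hμ0 hμ_smul hνcont hΦcont
    hstep hfG)
  refine ⟨min (σ * GG κ α R * η - σ ^ 2 * FF κ α q₂) ((1 - σ ^ 2) * FF κ α R - FF κ α q₂),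
    lt_min hσa hσb, ?_⟩
  intro q hq w hw hwK
  refine le_iInf fun z => le_iInf fun hz => le_trans (ENNReal.ofReal_le_ofReal ?_) (hD w z)
  have hq0 : 0 < q := by linarith [hq.1]
  have hq1 : 1 < q := by linarith [hq.1]
  have hνw : gauge Qs w = q := by
    obtain ⟨y, hy, rfl⟩ := hw
    have := (hfront y).1 hy
    simp only
    rw [gauge_smul_of_nonneg hq0.le, this]; simp
  have hνz := (hfront z).1 hz
  have hbz : gauge C z ≤ 1 := gauge_le_one_of_mem (hQsC (hfQs hz))
  have hbw : 1 + η ≤ gauge C w := by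
    by_contra hcon
    push Not at hcon
    have h1 : q ≤ |h w| := by
      have := hνmax w
      rw [hνw, le_max_iff] at this
      rcases this with h | h
      · exact h
      · linarith [hq.1]
    have h2 : |h w| = q := le_antisymm (by rw [← hνw]; exact hhν w) h1
    have h3 := hmemC w (1 + η) (by linarith) hcon
    set y := T ((1 + η)⁻¹ • w) with hy
    have hTw : T w = (1 + η) • y := by
      rw [hy, map_smul, smul_inv_smul₀ (by linarith)]
    have hhy : h y = 0 := by rw [hh, hQplane y h3]; simp
    have hTy : T y = s⁻¹ • y := by rw [hT, hhy]; simp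
    have hyx := hQplane y h3
    have hdist : ‖(s * η) • y‖ < ε := by
      rw [norm_smul, Real.norm_eq_abs, abs_of_pos (by positivity)]
      have := hB y h3
      calc _ ≤ s * η * B := by gcongr
        _ < ε := by linarith
    have hTc : ∀ c : ℝ, T (s • y + c • x) = y := by
      intro c
      rw [map_add, map_smul, map_smul, hTx, hTy, smul_inv_smul₀ hs0.ne']; simp
    have hhc : ∀ c : ℝ, h (s • y + c • x) = c := by
      intro c
      rw [map_add, map_smul, map_smul, hhx, hhy]; simp
    have hwd := hdecomp w
    rw [hTw] at hwd
    rcases abs_eq hq0.le |>.1 h2 with h4 | h4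
    · have hmem : s • y + q • x ∈ Kq q := by
        rw [hKq]
        left
        refine ⟨s • y + (1 : ℝ) • x, ⟨?_, ?_⟩, ?_⟩
        · rw [hPx]
          simp [inner_smul_left, hyx]
        · apply hxQ
          · rw [hhc]; simp
          · rw [hTc]; exact h3
        · simp only; module
      have h5 := hwK _ hmem
      have h6 : w - (s • y + q • x) = (s * η) • y := by
        rw [hwd, h4]; module
      rw [dist_eq_norm, h6] at h5
      linarith
    · have hmem : s • y + (-q) • x ∈ Kq q := by
        rw [hKq]
        right
        refine ⟨s • y + (-1 : ℝ) • x, ⟨?_, ?_⟩, ?_⟩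
        · rw [hPnx]
          simp [inner_smul_left, hyx]
        · apply hxQ
          · rw [hhc]; simp
          · rw [hTc]; exact h3
        · simp only; module
      have h5 := hwK _ hmem
      have h6 : w - (s • y + (-q) • x) = (s * η) • y := by
        rw [hwd, h4]; module
      rw [dist_eq_norm, h6] at h5
      linarith
  have hFq : (1 - q ^ (1 - α)) / (κ * (α - 1)) = FF κ α q := by
    unfold FF; rw [max_eq_left hq1.le]
  rw [hFq]
  have hFq2 : FF κ α q ≤ FF κ α q₂ := FF_mono hκ0 hα hq.2
  have hΦz : Φ z ≤ σ * GG κ α R := by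
    simp only [hΦ]; unfold PP
    refine (min_le_left _ _).trans ?_
    rw [hνz, FF_one, max_eq_right hbz, min_eq_left (by linarith)]
    simp
  have hΦw : Φ w = min ((1 - σ ^ 2) * FF κ α q + σ * GG κ α R * (1 + η))
    ((1 - σ ^ 2) * FF κ α R + σ * GG κ α R) := by
    simp only [hΦ]; unfold PP
    rw [hνw, max_eq_left (by linarith), min_eq_right hbw]
  have hm1 := min_le_left (σ * GG κ α R * η - σ ^ 2 * FF κ α q₂)
    ((1 - σ ^ 2) * FF κ α R - FF κ α q₂)
  have hm2 := min_le_right (σ * GG κ α R * η - σ ^ 2 * FF κ α q₂)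
    ((1 - σ ^ 2) * FF κ α R - FF κ α q₂)
  have h7 : σ ^ 2 * FF κ α q ≤ σ ^ 2 * FF κ α q₂ := by gcongr
  have : FF κ α q + min (σ * GG κ α R * η - σ ^ 2 * FF κ α q₂)
    ((1 - σ ^ 2) * FF κ α R - FF κ α q₂) + σ * GG κ α R ≤ Φ w := by
    rw [hΦw]
    apply le_min
    · linarith
    · linarith
  linarith
end
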